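/- There exists a constant c > 0 with the following property. Let w be a weighting on a finite set V with |V| = n ≥ 3, whose edge set E(w) has m elements and whose graph (V, E(w)) is connected, and let A = L_w be its Laplacian. Then for every positive integer t ≤ n there exist a set R ⊆ E(w) such that (V, R) is a spanning tree of (V, E(w)), and a set S ⊆ E(w) with |S| ≤ c · t² · (log n)/(log log n), such that the Laplacian B = L_{w|_{R∪S}} satisfies: for every x ∈ ℝ^V, xᵀBx ≤ xᵀAx and xᵀAx ≤ (m/t) · 2^{c·√(log n · log log n)} · xᵀBx. (In particular κ_f(A,B) ≤ (m/t) · 2^{c·√(log n · log log n)}.) -/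

import Mathlib

open Matrix Finset

noncomputable section

/-- The Laplacian matrix of a weighting `w` on a finite vertex set `V`. -/
def lap {V : Type*} [Fintype V] [DecidableEq V] (w : V → V → ℝ) : Matrix V V ℝ :=
  fun u v => if u = v then ∑ x, w v x else -(w u v)

/-- A weighting on `V`: symmetric, nonnegative, zero on the diagonal. -/
structure IsWeighting {V : Type*} (w : V → V → ℝ) : Prop where
  symm : ∀ u v, w u v = w v u
  nonneg : ∀ u v, 0 ≤ w u v
  diag : ∀ v, w v v = 0

/-- The edge set of a weighting: unordered pairs of distinct vertices of positive weight. -/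
def edgeSetW {V : Type*} (w : V → V → ℝ) : Set (Sym2 V) :=
  {e | ∃ u v, e = s(u, v) ∧ u ≠ v ∧ 0 < w u v}

open Classical in
/-- The restriction of a weighting to a set `F` of unordered pairs. -/
def restrictW {V : Type*} (w : V → V → ℝ) (F : Set (Sym2 V)) : V → V → ℝ :=
  fun u v => if s(u, v) ∈ F then w u v else 0

section BallGrowing

variable {W : Type*} [DecidableEq W]

open Classical in
/-- The ball of radius `k` around `x₀` inside `U`, for the relation `adj`. -/
def ballIn (adj : W → W → Prop) (U : Finset W) (x₀ : W) : ℕ → Finset W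
  | 0 => {x₀}
  | k + 1 => ballIn adj U x₀ k ∪ {y ∈ U | ∃ x ∈ ballIn adj U x₀ k, adj y x}

lemma mem_ballIn_succ {adj : W → W → Prop} {U : Finset W} {x₀ : W} {k : ℕ} {y : W} :
    y ∈ ballIn adj U x₀ (k + 1) ↔
      y ∈ ballIn adj U x₀ k ∨ y ∈ U ∧ ∃ x ∈ ballIn adj U x₀ k, adj y x := by
  simp [ballIn]

lemma center_mem_ballIn (adj : W → W → Prop) (U : Finset W) (x₀ : W) (k : ℕ) :
    x₀ ∈ ballIn adj U x₀ k := by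
  induction k with
  | zero => simp [ballIn]
  | succ k ih => simp [ballIn, ih]

lemma ballIn_subset (adj : W → W → Prop) {U : Finset W} {x₀ : W} (hx : x₀ ∈ U) (k : ℕ) :
    ballIn adj U x₀ k ⊆ U := by
  induction k with
  | zero => simpa [ballIn] using hx
  | succ k ih => exact fun y hy => (mem_ballIn_succ.1 hy).elim (fun h => ih h) And.left

/-- Some ball of radius less than `R` has a small boundary compared with its volume. -/
lemma exists_ballIn_boundary_le [Fintype W] (adj : W → W → Prop) (c : W → W → ℝ) (hc : ∀ x y, 0 ≤ c x y)
    (hsymm : ∀ x y, c x y = c y x) (hadj : ∀ x y, c x y ≠ 0 → x ≠ y → adj x y)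
    {ε τ : ℝ} (hε : 0 < ε) (hτ : 0 ≤ τ) {R : ℕ}
    (hR : ∑ x, ∑ y, c x y + τ ≤ (1 + ε) ^ R * τ) {U : Finset W} {x₀ : W} (hx₀ : x₀ ∈ U) :
    ∃ k ≤ R, ∑ x ∈ ballIn adj U x₀ k, ∑ y ∈ U \ ballIn adj U x₀ k, c x y ≤
      ε * (τ + ∑ x ∈ ballIn adj U x₀ k, ∑ y ∈ U, c x y) := by
  by_contra! hcon
  set B := ballIn adj U x₀
  have hgrow : ∀ k, ∑ x ∈ B k, ∑ y ∈ U, c x y + ∑ x ∈ B k, ∑ y ∈ U \ B k, c x y ≤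
      ∑ x ∈ B (k + 1), ∑ y ∈ U, c x y := by
    intro k
    have hsub : B k ⊆ B (k + 1) := subset_union_left
    rw [← sum_sdiff hsub, add_comm]
    gcongr ?_ + _
    rw [sum_comm]
    calc ∑ y ∈ U \ B k, ∑ x ∈ B k, c x y
        = ∑ y ∈ B (k + 1) \ B k, ∑ x ∈ B k, c x y := by
          symm
          apply sum_subset
          · exact sdiff_subset_sdiff (ballIn_subset adj hx₀ _) (Subset.refl _)
          · intro y hy hy'
            apply sum_eq_zero
            intro x hx
            by_contra hne
            rw [mem_sdiff] at hy
            apply hy'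
            rw [mem_sdiff]
            refine ⟨?_, hy.2⟩
            have : adj y x := hadj y x (by rwa [hsymm]) (by rintro rfl; exact hy.2 hx)
            exact mem_ballIn_succ.2 (Or.inr ⟨hy.1, x, hx, this⟩)
      _ ≤ ∑ y ∈ B (k + 1) \ B k, ∑ x ∈ U, c y x := by
          gcongr with y hy
          simp_rw [hsymm y]
          exact sum_le_sum_of_subset_of_nonneg (ballIn_subset adj hx₀ _)
            fun x _ _ => hc x y
  have hvol : ∀ k, k ≤ R + 1 → (1 + ε) ^ k * τ ≤ τ + ∑ x ∈ B k, ∑ y ∈ U, c x y := by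
    intro k
    induction k with
    | zero => intro _; simpa using sum_nonneg fun x _ => sum_nonneg fun y _ => hc x y
    | succ k ih =>
      intro hk
      have h1 := ih (by omega)
      have h2 := hcon k (by omega)
      have h3 := hgrow k
      rw [pow_succ]
      nlinarith
  have h1 := hvol R (by omega)
  have h2 := hcon R le_rfl
  have h3 := hgrow R
  have h4 : ∑ x ∈ B (R + 1), ∑ y ∈ U, c x y ≤ ∑ x, ∑ y, c x y :=
    (sum_le_sum_of_subset_of_nonneg (subset_univ _)
      fun x _ _ => sum_nonneg fun y _ => hc x y).trans
    (sum_le_sum fun x _ => sum_le_sum_of_subset_of_nonneg (subset_univ _)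
      fun y _ _ => hc x y)
  have h5 : 0 ≤ (1 + ε) ^ R * τ := by positivity
  nlinarith

/-- Inside a ball every point other than the center has a neighbour of smaller height. -/
lemma exists_height_ballIn (adj : W → W → Prop) (U : Finset W) (x₀ : W) (k : ℕ) :
    ∃ h : W → ℕ, ∀ x ∈ ballIn adj U x₀ k, h x ≤ k ∧
      (x = x₀ ∨ ∃ y ∈ ballIn adj U x₀ k, adj x y ∧ h y < h x) := by
  induction k with
  | zero => exact ⟨0, by simp [ballIn]⟩
  | succ k ih =>
    obtain ⟨h, hh⟩ := ih
    refine ⟨fun x => if x ∈ ballIn adj U x₀ k then h x else k + 1, fun x hx => ?_⟩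
    by_cases hxk : x ∈ ballIn adj U x₀ k
    · obtain ⟨h1, h2⟩ := hh x hxk
      refine ⟨by simp only [hxk, if_true]; omega, h2.imp_right ?_⟩
      rintro ⟨y, hy, hxy, hlt⟩
      exact ⟨y, mem_union_left _ hy, hxy, by simpa [hxk, hy] using hlt⟩
    · refine ⟨by simp [hxk], Or.inr ?_⟩
      rcases mem_ballIn_succ.1 hx with hx | hx
      · exact absurd hx hxk
      · obtain ⟨y, hy, hxy⟩ := hx.2
        refine ⟨y, mem_union_left _ hy, hxy, ?_⟩
        have := (hh y hy).1
        simp only [hxk, hy, if_true, if_false]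
        omega

/-- Low diameter decomposition: a partition into clusters (`f` sends a point to the center of its
cluster), each of radius at most `R`, such that the total weight between clusters is small. -/
lemma exists_lowDiameter_decomposition [Fintype W] (adj : W → W → Prop) (c : W → W → ℝ)
    (hc : ∀ x y, 0 ≤ c x y) (hsymm : ∀ x y, c x y = c y x)
    (hadj : ∀ x y, c x y ≠ 0 → x ≠ y → adj x y)
    {ε τ : ℝ} (hε : 0 < ε) (hτ : 0 ≤ τ) {R : ℕ}
    (hR : ∑ x, ∑ y, c x y + τ ≤ (1 + ε) ^ R * τ) (U : Finset W) :
    ∃ (f : W → W) (h : W → ℕ),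
      (∀ x ∈ U, f x ∈ U ∧ h x ≤ R ∧
        (x = f x ∨ ∃ y ∈ U, adj x y ∧ f y = f x ∧ h y < h x)) ∧
      ∑ x ∈ U, ∑ y ∈ U, (if f x ≠ f y then c x y else 0) ≤
        2 * ε * (∑ x ∈ U, ∑ y ∈ U, c x y + #U * τ) := by
  induction U using Finset.strongInduction with
  | H U ih =>
  rcases U.eq_empty_or_nonempty with rfl | ⟨x₀, hx₀⟩
  · exact ⟨id, 0, by simp, by simp⟩
  obtain ⟨k, hkR, hcut⟩ := exists_ballIn_boundary_le adj c hc hsymm hadj hε hτ hR hx₀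
  obtain ⟨h₁, hh₁⟩ := exists_height_ballIn adj U x₀ k
  have hBU := ballIn_subset adj hx₀ k
  have hxB := center_mem_ballIn adj U x₀ k
  set B := ballIn adj U x₀ k
  obtain ⟨f, h, hfh, hsum⟩ := ih (U \ B) (sdiff_ssubset hBU ⟨x₀, hxB⟩)
  refine ⟨fun x => if x ∈ B then x₀ else f x, fun x => if x ∈ B then h₁ x else h x, ?_, ?_⟩
  · intro x hx
    by_cases hxB' : x ∈ B
    · obtain ⟨h1, h2⟩ := hh₁ x hxB'
      simp only [hxB', if_true]
      refine ⟨hx₀, h1.trans hkR, h2.imp_right ?_⟩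
      rintro ⟨y, hy, hxy, hlt⟩
      exact ⟨y, hBU hy, hxy, by simp [hy], by simpa [hy] using hlt⟩
    · obtain ⟨h1, h2, h3⟩ := hfh x (mem_sdiff.2 ⟨hx, hxB'⟩)
      simp only [hxB', if_false]
      refine ⟨(mem_sdiff.1 h1).1, h2, h3.imp_right ?_⟩
      rintro ⟨y, hy, hxy, hfy, hlt⟩
      have hyB := (mem_sdiff.1 hy).2
      exact ⟨y, (mem_sdiff.1 hy).1, hxy, by simpa [hyB] using hfy, by simpa [hyB] using hlt⟩
  · set g : W → W := fun x => if x ∈ B then x₀ else f x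
    have split : ∀ F : W → W → ℝ, ∑ x ∈ U, ∑ y ∈ U, F x y =
        ∑ x ∈ U \ B, ∑ y ∈ U \ B, F x y + ∑ x ∈ U \ B, ∑ y ∈ B, F x y
          + ∑ x ∈ B, ∑ y ∈ U, F x y := by
      intro F
      rw [← sum_sdiff hBU, ← sum_add_distrib]
      congr 1
      exact sum_congr rfl fun x _ => (sum_sdiff hBU).symm
    have e1 : ∑ x ∈ U \ B, ∑ y ∈ U \ B, (if g x ≠ g y then c x y else 0) =
        ∑ x ∈ U \ B, ∑ y ∈ U \ B, (if f x ≠ f y then c x y else 0) := by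
      refine sum_congr rfl fun x hx => sum_congr rfl fun y hy => ?_
      simp [g, (mem_sdiff.1 hx).2, (mem_sdiff.1 hy).2]
    have e2 : ∑ x ∈ U \ B, ∑ y ∈ B, (if g x ≠ g y then c x y else 0) ≤
        ∑ x ∈ B, ∑ y ∈ U \ B, c x y := by
      rw [sum_comm]
      refine sum_le_sum fun x _ => sum_le_sum fun y _ => ?_
      split_ifs
      · exact (hsymm _ _).le
      · exact hc _ _
    have e3 : ∑ x ∈ B, ∑ y ∈ U, (if g x ≠ g y then c x y else 0) ≤
        ∑ x ∈ B, ∑ y ∈ U \ B, c x y := by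
      refine sum_le_sum fun x hx => ?_
      rw [← sum_sdiff hBU, sum_eq_zero (s := B), add_zero]
      · refine sum_le_sum fun y _ => ?_
        split_ifs
        · exact le_rfl
        · exact hc _ _
      · intro y hy
        simp [g, hx, hy]
    have e4 : 0 ≤ ∑ x ∈ U \ B, ∑ y ∈ B, c x y :=
      sum_nonneg fun x _ => sum_nonneg fun y _ => hc x y
    have e5 : (#(U \ B) : ℝ) + 1 ≤ #U := by
      exact_mod_cast card_lt_card (sdiff_ssubset hBU ⟨x₀, hxB⟩)
    rw [split, split c, e1]
    have e6 : ε * (((#(U \ B) : ℝ) + 1) * τ) ≤ ε * (#U * τ) := by gcongr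
    nlinarith

end BallGrowing

section Forest

variable {V : Type*}

/-- The total length of a walk, for a length function on unordered pairs. -/
def walkLen (d : Sym2 V → ℝ) {G : SimpleGraph V} {u v : V} (p : G.Walk u v) : ℝ :=
  (p.edges.map d).sum

lemma walkLen_append (d : Sym2 V → ℝ) {G : SimpleGraph V} {u v x : V} (p : G.Walk u v)
    (q : G.Walk v x) : walkLen d (p.append q) = walkLen d p + walkLen d q := by
  simp [walkLen, SimpleGraph.Walk.edges_append]

lemma walkLen_cons (d : Sym2 V → ℝ) {G : SimpleGraph V} {u v x : V} (h : G.Adj u v)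
    (q : G.Walk v x) : walkLen d (q.cons h) = d s(u, v) + walkLen d q := by
  simp [walkLen]

lemma walkLen_reverse (d : Sym2 V → ℝ) {G : SimpleGraph V} {u v : V} (p : G.Walk u v) :
    walkLen d p.reverse = walkLen d p := by
  simp [walkLen, SimpleGraph.Walk.edges_reverse]

lemma walkLen_mapLe (d : Sym2 V → ℝ) {G H : SimpleGraph V} (hle : G ≤ H) {u v : V}
    (p : G.Walk u v) : walkLen d (p.mapLe hle) = walkLen d p := by
  simp [walkLen]

lemma eq_of_reachable {G : SimpleGraph V} {α : Type*} {g : V → α}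
    (hg : ∀ u v, G.Adj u v → g u = g v) {u v : V} (h : G.Reachable u v) : g u = g v := by
  obtain ⟨p⟩ := h
  induction p with
  | nil => rfl
  | cons hadj _ ih => exact (hg _ _ hadj).trans ih

/-- Attaching every component in `s` to a component of smaller height by a single edge keeps a
forest acyclic. -/
lemma isAcyclic_sup_attach {F : SimpleGraph V} (hF : F.IsAcyclic) (h : F.ConnectedComponent → ℕ)
    (a b : F.ConnectedComponent → V) (s : Finset F.ConnectedComponent)
    (ha : ∀ X ∈ s, F.connectedComponentMk (a X) = X)
    (hb : ∀ X ∈ s, h (F.connectedComponentMk (b X)) < h X) :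
    (F ⊔ SimpleGraph.fromEdgeSet ((fun X => s(a X, b X)) '' s)).IsAcyclic := by
  classical
  induction s using Finset.induction_on_max_value h with
  | empty => simpa using hF
  | insert X s hXs hmax ih =>
    have ih' := ih (fun Y hY => ha Y (mem_insert_of_mem hY))
      (fun Y hY => hb Y (mem_insert_of_mem hY))
    have heq : F ⊔ SimpleGraph.fromEdgeSet ((fun X => s(a X, b X)) '' (insert X s : Finset _)) =
        F ⊔ SimpleGraph.fromEdgeSet ((fun X => s(a X, b X)) '' s) ⊔
          SimpleGraph.edge (a X) (b X) := by
      rw [coe_insert, Set.image_insert_eq, Set.insert_eq, SimpleGraph.fromEdgeSet_union,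
        SimpleGraph.edge, sup_assoc, sup_comm (SimpleGraph.fromEdgeSet _)]
    rw [heq]
    refine SimpleGraph.IsAcyclic.sup_edge_of_not_reachable ?_ ih'
    intro hreach
    have hcl : ∀ u v, (F ⊔ SimpleGraph.fromEdgeSet ((fun X => s(a X, b X)) '' s)).Adj u v →
        (F.connectedComponentMk u = X) = (F.connectedComponentMk v = X) := by
      intro u v huv
      rcases huv with huv | huv
      · rw [SimpleGraph.ConnectedComponent.sound huv.reachable]
      · obtain ⟨⟨Y, hY, hYe⟩, -⟩ := (SimpleGraph.fromEdgeSet_adj _).1 huv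
        have hY' : Y ∈ s := hY
        have hYX : Y ≠ X := by rintro rfl; exact hXs hY'
        have h1 : F.connectedComponentMk (a Y) ≠ X := by
          rw [ha Y (mem_insert_of_mem hY')]; exact hYX
        have h2 : F.connectedComponentMk (b Y) ≠ X := by
          intro h2
          have h3 := hb Y (mem_insert_of_mem hY')
          rw [h2] at h3
          exact absurd (hmax Y hY') (by omega)
        rcases Sym2.eq_iff.1 hYe with ⟨rfl, rfl⟩ | ⟨rfl, rfl⟩ <;> simp [h1, h2]
    have h1 := eq_of_reachable hcl hreach
    rw [ha X (mem_insert_self _ _)] at h1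
    have h2 := hb X (mem_insert_self _ _)
    rw [← h1.mp rfl] at h2
    simp only [h1.mp rfl, lt_irrefl] at h2

/-- Summing over pairs of fibers. -/
lemma sum_sum_fiberwise {W : Type*} [Fintype V] [Fintype W] [DecidableEq W] (g : V → W)
    (F : V → V → ℝ) :
    ∑ X, ∑ Y, ∑ u with g u = X, ∑ v with g v = Y, F u v = ∑ u, ∑ v, F u v := by
  calc ∑ X, ∑ Y, ∑ u with g u = X, ∑ v with g v = Y, F u v
      = ∑ X, ∑ u with g u = X, ∑ Y, ∑ v with g v = Y, F u v :=
        sum_congr rfl fun X _ => sum_comm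
    _ = ∑ X, ∑ u with g u = X, ∑ v, F u v :=
        sum_congr rfl fun X _ => sum_congr rfl fun u _ => sum_fiberwise _ _ _
    _ = _ := sum_fiberwise _ _ _

/-- One round of clustering: a forest whose components have diameter at most `L` is extended by
edges of length at most `L` to a forest whose components have diameter at most `(4R+2)L`, so that
only a small part of the weight `c` remains between different components. -/
lemma exists_forest_coarsening [Fintype V] {F H : SimpleGraph V} (hF : F.IsAcyclic)
    {d : Sym2 V → ℝ} {L : ℝ} (hL : 0 ≤ L)
    (hd : ∀ u v, F.Reachable u v → ∃ p : F.Walk u v, walkLen d p ≤ L)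
    (hH : ∀ u v, H.Adj u v → d s(u, v) ≤ L)
    {c : V → V → ℝ} (hc : ∀ u v, 0 ≤ c u v) (hsymm : ∀ u v, c u v = c v u)
    (hcH : ∀ u v, c u v ≠ 0 → H.Adj u v) {ε : ℝ} (hε : 0 < ε) {R : ℕ}
    (hR : (Fintype.card V : ℝ) + 1 ≤ (1 + ε) ^ R) :
    ∃ F' : SimpleGraph V, F ≤ F' ∧ F' ≤ F ⊔ H ∧ F'.IsAcyclic ∧
      (∀ u v, F'.Reachable u v → ∃ p : F'.Walk u v, walkLen d p ≤ (4 * R + 2) * L) ∧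
      (∀ D : V → V → Prop, (∀ u v, D u v → ¬ F'.Reachable u v) → [∀ u v, Decidable (D u v)] →
        ∑ u, ∑ v, (if D u v then c u v else 0) ≤ 4 * ε * ∑ u, ∑ v, c u v) := by
  classical
  set W := F.ConnectedComponent
  set mk : V → W := F.connectedComponentMk
  have : Fintype W := Fintype.ofFinite W
  set cc : W → W → ℝ := fun X Y => ∑ u with mk u = X, ∑ v with mk v = Y, c u v with hcc
  have hcc0 : ∀ X Y, 0 ≤ cc X Y := fun X Y => sum_nonneg fun u _ => sum_nonneg fun v _ => hc u v
  have htot : ∑ X, ∑ Y, cc X Y = ∑ u, ∑ v, c u v := sum_sum_fiberwise mk c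
  set C := ∑ u, ∑ v, c u v
  have hC : 0 ≤ C := sum_nonneg fun u _ => sum_nonneg fun v _ => hc u v
  have hCτ : C = Fintype.card V * (C / Fintype.card V) := by
    rcases isEmpty_or_nonempty V with hV | hV
    · simp [C]
    · field_simp
  have hτ : 0 ≤ C / Fintype.card V := by positivity
  obtain ⟨f, h, hfh, hcut⟩ := exists_lowDiameter_decomposition (W := W)
    (fun X Y => ∃ u v, mk u = X ∧ mk v = Y ∧ H.Adj u v) cc hcc0
    (fun X Y => by
      simp only [hcc]
      rw [sum_comm]
      exact sum_congr rfl fun u _ => sum_congr rfl fun v _ => hsymm _ _)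
    (fun X Y hne _ => by
      obtain ⟨u, hu, hne⟩ := exists_ne_zero_of_sum_ne_zero hne
      obtain ⟨v, hv, hne⟩ := exists_ne_zero_of_sum_ne_zero hne
      exact ⟨u, v, (mem_filter.1 hu).2, (mem_filter.1 hv).2, hcH u v hne⟩)
    (τ := C / Fintype.card V) hε hτ (R := R)
    (by
      rw [htot]
      nlinarith [mul_le_mul_of_nonneg_right hR hτ]) univ
  have hpar : ∀ X : W, ∃ u v, X ≠ f X → mk u = X ∧ H.Adj u v ∧ f (mk v) = f X ∧ h (mk v) < h X := by
    intro X
    by_cases hX : X = f X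
    · obtain ⟨x, -⟩ := X.exists_rep
      exact ⟨x, x, fun h => absurd hX h⟩
    · obtain ⟨-, -, h3⟩ := hfh X (mem_univ _)
      obtain ⟨Y, -, ⟨u, v, hu, hv, huv⟩, hfY, hlt⟩ := h3.resolve_left hX
      subst hv
      exact ⟨u, v, fun _ => ⟨hu, huv, hfY, hlt⟩⟩
  choose a b hab using hpar
  set s : Finset W := {X | X ≠ f X}
  have hs : ∀ X, X ∈ s ↔ X ≠ f X := fun X => by simp [s]
  set F' := F ⊔ SimpleGraph.fromEdgeSet ((fun X => s(a X, b X)) '' s) with hF'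
  have hle : F ≤ F' := le_sup_left
  have hedge : ∀ X, X ≠ f X → F'.Adj (a X) (b X) := by
    intro X hX
    refine Or.inr ((SimpleGraph.fromEdgeSet_adj _).2 ⟨⟨X, (hs X).2 hX, rfl⟩, ?_⟩)
    exact (hab X hX).2.1.ne
  have hfconst : ∀ u v, F'.Adj u v → f (mk u) = f (mk v) := by
    intro u v huv
    rcases huv with huv | huv
    · exact congrArg f (SimpleGraph.ConnectedComponent.sound huv.reachable)
    · obtain ⟨⟨X, hX, hXe⟩, -⟩ := (SimpleGraph.fromEdgeSet_adj _).1 huv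
      obtain ⟨h1, -, h2, -⟩ := hab X ((hs X).1 hX)
      rcases Sym2.eq_iff.1 hXe with ⟨rfl, rfl⟩ | ⟨rfl, rfl⟩
      · rw [h1, h2]
      · rw [h1, h2]
  have hwalk : ∀ (k : ℕ) (v z : V), h (mk v) ≤ k → mk z = f (mk v) →
      ∃ p : F'.Walk v z, walkLen d p ≤ (2 * k + 1) * L := by
    intro k
    induction k using Nat.strong_induction_on with
    | _ k ih =>
    intro v z hk hz
    by_cases hX : mk v = f (mk v)
    · obtain ⟨p, hp⟩ := hd v z (SimpleGraph.ConnectedComponent.exact (hX.trans hz.symm))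
      refine ⟨p.mapLe hle, ?_⟩
      rw [walkLen_mapLe]
      nlinarith [mul_nonneg (Nat.cast_nonneg (α := ℝ) k) hL]
    · obtain ⟨h1, h2, h3, h4⟩ := hab _ hX
      obtain ⟨p, hp⟩ := hd v (a (mk v)) (SimpleGraph.ConnectedComponent.exact h1.symm)
      obtain ⟨q, hq⟩ := ih (h (mk (b (mk v)))) (by omega) (b (mk v)) z le_rfl (by rw [hz, h3])
      refine ⟨(p.mapLe hle).append (q.cons (hedge _ hX)), ?_⟩
      rw [walkLen_append, walkLen_cons, walkLen_mapLe]
      have h5 := hH _ _ h2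
      have h6 : (h (mk (b (mk v))) : ℝ) + 1 ≤ k := by exact_mod_cast (by omega)
      nlinarith
  refine ⟨F', hle, ?_, ?_, ?_, ?_⟩
  · refine sup_le_sup_left ?_ _
    intro u v huv
    obtain ⟨⟨X, hX, hXe⟩, -⟩ := (SimpleGraph.fromEdgeSet_adj _).1 huv
    obtain ⟨-, h1, -⟩ := hab X ((hs X).1 hX)
    rcases Sym2.eq_iff.1 hXe with ⟨rfl, rfl⟩ | ⟨rfl, rfl⟩
    · exact h1
    · exact h1.symm
  · exact isAcyclic_sup_attach hF h a b s (fun X hX => (hab X ((hs X).1 hX)).1)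
      (fun X hX => (hab X ((hs X).1 hX)).2.2.2)
  · intro u v huv
    have hfuv := eq_of_reachable hfconst huv
    obtain ⟨z, hz⟩ := (f (mk u)).exists_rep
    obtain ⟨p, hp⟩ := hwalk R u z (hfh _ (mem_univ _)).2.1 hz
    obtain ⟨q, hq⟩ := hwalk R v z (hfh _ (mem_univ _)).2.1 (hfuv ▸ hz)
    refine ⟨p.append q.reverse, ?_⟩
    rw [walkLen_append, walkLen_reverse]
    linarith
  · intro D hD _
    have hreach : ∀ u v, f (mk u) = f (mk v) → F'.Reachable u v := by
      intro u v huv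
      obtain ⟨z, hz⟩ := (f (mk u)).exists_rep
      obtain ⟨p, -⟩ := hwalk R u z (hfh _ (mem_univ _)).2.1 hz
      obtain ⟨q, -⟩ := hwalk R v z (hfh _ (mem_univ _)).2.1 (huv ▸ hz)
      exact ⟨p.append q.reverse⟩
    have hcard : (Fintype.card W : ℝ) ≤ Fintype.card V := by
      exact_mod_cast Fintype.card_le_of_surjective mk fun X => X.exists_rep
    calc ∑ u, ∑ v, (if D u v then c u v else 0)
        ≤ ∑ u, ∑ v, (if f (mk u) ≠ f (mk v) then c u v else 0) := by
          refine sum_le_sum fun u _ => sum_le_sum fun v _ => ?_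
          by_cases h1 : D u v
          · have : f (mk u) ≠ f (mk v) := fun h2 => hD u v h1 (hreach u v h2)
            simp [h1, this]
          · rw [if_neg h1]
            split_ifs
            · exact hc u v
            · exact le_rfl
      _ = ∑ X, ∑ Y, (if f X ≠ f Y then cc X Y else 0) := by
          rw [← sum_sum_fiberwise mk]
          refine sum_congr rfl fun X _ => sum_congr rfl fun Y _ => ?_
          rw [hcc]
          split_ifs with hXY
          · refine sum_congr rfl fun u hu => sum_congr rfl fun v hv => ?_
            rw [(mem_filter.1 hu).2, (mem_filter.1 hv).2, if_pos hXY]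
          · refine sum_eq_zero fun u hu => sum_eq_zero fun v hv => ?_
            rw [(mem_filter.1 hu).2, (mem_filter.1 hv).2, if_neg hXY]
      _ ≤ 2 * ε * (C + Fintype.card W * (C / Fintype.card V)) := by
          rw [← htot]
          simpa [htot] using hcut
      _ ≤ 4 * ε * C := by
          have := mul_le_mul_of_nonneg_right hcard hτ
          have h2 : C + Fintype.card W * (C / Fintype.card V) ≤ 2 * C := by linarith
          nlinarith

end Forest

section LowStretch

variable {V : Type*} [Fintype V]

/-- The forests built by `j` rounds of clustering. An edge `e` belongs to the length class `i e`
and becomes active in round `i e`; the exponent `s` counts the rounds after which it is joined. -/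
lemma exists_forest_after_rounds {G : SimpleGraph V} {d : Sym2 V → ℝ} {δ y K : ℝ} (hδ : 0 < δ)
    (hK : 1 < K) {R : ℕ} (hy : 4 * R + 2 ≤ y)
    (hR : (Fintype.card V : ℝ) + 1 ≤ (1 + 1 / (8 * K)) ^ R) {i : Sym2 V → ℕ}
    (hi : ∀ u v, G.Adj u v → d s(u, v) ≤ δ * y ^ i s(u, v)) (j : ℕ) :
    ∃ F ≤ G, F.IsAcyclic ∧
      (∀ u v, F.Reachable u v → ∃ p : F.Walk u v, walkLen d p ≤ δ * y ^ j) ∧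
      ∃ s : V → V → ℕ,
        (∀ u v, G.Adj u v → i s(u, v) < j → F.Reachable u v →
          ∃ p : F.Walk u v, walkLen d p ≤ δ * y ^ (i s(u, v) + s u v + 1)) ∧
        ∀ [∀ u v, Decidable (G.Adj u v ∧ i s(u, v) < j)] [∀ u v, Decidable (F.Reachable u v)],
        ∑ u, ∑ v, (if G.Adj u v ∧ i s(u, v) < j then
            (if F.Reachable u v then K ^ s u v else 2 * K ^ (j - i s(u, v))) else 0) ≤
          2 * ∑ u, ∑ v, (if G.Adj u v ∧ i s(u, v) < j then (1 : ℝ) else 0) := by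
  classical
  have hy1 : 1 ≤ y := by have : (0 : ℝ) ≤ R := by positivity
                         linarith
  have hK0 : 0 < K := by linarith
  induction j with
  | zero =>
    refine ⟨⊥, bot_le, SimpleGraph.isAcyclic_bot, ?_, 0, by simp, by simp⟩
    intro u v huv
    obtain rfl := SimpleGraph.reachable_bot.1 huv
    exact ⟨.nil, by simpa [walkLen] using hδ.le⟩
  | succ j ih =>
    obtain ⟨F, hFG, hF, hd, s, hs, hsum⟩ := ih
    set c : V → V → ℝ := fun u v =>
      if G.Adj u v ∧ i s(u, v) ≤ j ∧ ¬ F.Reachable u v then K ^ (j - i s(u, v)) else 0 with hcdef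
    have hc0 : ∀ u v, 0 ≤ c u v := fun u v => by
      simp only [hcdef]; split_ifs <;> positivity
    let H : SimpleGraph V :=
      { Adj := fun u v => G.Adj u v ∧ i s(u, v) ≤ j
        symm := ⟨fun u v h => ⟨h.1.symm, by rw [Sym2.eq_swap]; exact h.2⟩⟩
        loopless := ⟨fun u h => G.loopless.irrefl u h.1⟩ }
    obtain ⟨F', hFF', hF'H, hF', hd', hcut⟩ := exists_forest_coarsening (H := H) hF (d := d)
      (L := δ * y ^ j) (by positivity) hd
      (fun u v huv => (hi u v huv.1).trans (by
        have := pow_le_pow_right₀ hy1 huv.2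
        gcongr))
      hc0
      (fun u v => by
        simp only [hcdef]
        simp only [Sym2.eq_swap (a := u), G.adj_comm u,
          show F.Reachable u v = F.Reachable v u from propext F.reachable_comm])
      (fun u v huv => by
        have : G.Adj u v ∧ i s(u, v) ≤ j ∧ ¬ F.Reachable u v := by
          by_contra h
          exact huv (if_neg h)
        exact ⟨this.1, this.2.1⟩)
      (ε := 1 / (8 * K)) (by positivity) hR
    have hlen : ∀ u v, F'.Reachable u v → ∃ p : F'.Walk u v, walkLen d p ≤ δ * y ^ (j + 1) := by
      intro u v huv
      obtain ⟨p, hp⟩ := hd' u v huv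
      refine ⟨p, hp.trans ?_⟩
      rw [pow_succ]
      have : 0 ≤ δ * y ^ j := by positivity
      nlinarith
    refine ⟨F', fun u v huv => ?_, hF', hlen, fun u v =>
      if F.Reachable u v then (if i s(u, v) < j then s u v else 0) else j - i s(u, v), ?_, ?_⟩
    · rcases hF'H huv with h | h
      · exact hFG h
      · exact h.1
    · intro u v huv hij hreach
      by_cases hFr : F.Reachable u v
      · by_cases hlt : i s(u, v) < j
        · obtain ⟨p, hp⟩ := hs u v huv hlt hFr
          exact ⟨p.mapLe hFF', by simpa [walkLen_mapLe, hFr, hlt] using hp⟩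
        · obtain ⟨p, hp⟩ := hd u v hFr
          refine ⟨p.mapLe hFF', ?_⟩
          simp only [walkLen_mapLe, hFr, hlt, if_true, if_false]
          refine hp.trans ?_
          have := pow_le_pow_right₀ hy1 (show j ≤ i s(u, v) + 0 + 1 by omega)
          gcongr
      · obtain ⟨p, hp⟩ := hlen u v hreach
        refine ⟨p, ?_⟩
        simp only [hFr, if_false]
        rwa [show i s(u, v) + (j - i s(u, v)) + 1 = j + 1 by omega]
    · intro _ _
      have hcut' := hcut (fun u v => ¬ F'.Reachable u v) (fun _ _ h => h)
      have hpoint : ∀ u v, (if G.Adj u v ∧ i s(u, v) < j + 1 then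
            (if F'.Reachable u v then
              K ^ (if F.Reachable u v then (if i s(u, v) < j then s u v else 0)
                else j - i s(u, v))
              else 2 * K ^ (j + 1 - i s(u, v))) else 0) ≤
          (if G.Adj u v ∧ i s(u, v) < j then
            (if F.Reachable u v then K ^ s u v else 2 * K ^ (j - i s(u, v))) else 0) +
          (2 * (if G.Adj u v ∧ i s(u, v) < j + 1 then 1 else 0) -
            2 * (if G.Adj u v ∧ i s(u, v) < j then 1 else 0)) +
          (2 * K * (if ¬ F'.Reachable u v then c u v else 0) - c u v) := by
        intro u v
        by_cases hadj : G.Adj u v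
        swap
        · simp [hadj, hcdef]
        by_cases hij : i s(u, v) < j + 1
        swap
        · have h1 : ¬ i s(u, v) < j := by omega
          have h2 : ¬ i s(u, v) ≤ j := by omega
          simp [hij, h1, h2, hcdef]
        have hij' : i s(u, v) ≤ j := by omega
        by_cases hFr : F.Reachable u v
        · have hFr' := hFr.mono hFF'
          by_cases hlt : i s(u, v) < j
          · simp [hadj, hij, hFr, hFr', hlt, hcdef]
          · simp [hadj, hij, hFr, hFr', hlt, hcdef]
        · have hpow : K ^ (j + 1 - i s(u, v)) = K * K ^ (j - i s(u, v)) := by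
            rw [← pow_succ', show j + 1 - i s(u, v) = j - i s(u, v) + 1 by omega]
          have hpos : 0 < K ^ (j - i s(u, v)) := by positivity
          by_cases hlt : i s(u, v) < j
          · by_cases hFr' : F'.Reachable u v
            · simp [hadj, hij, hFr, hFr', hlt, hij', hcdef]
              linarith
            · simp [hadj, hij, hFr, hFr', hlt, hij', hcdef, hpow]
              linarith
          · have hj : j - i s(u, v) = 0 := by omega
            by_cases hFr' : F'.Reachable u v
            · simp [hadj, hij, hFr, hFr', hlt, hij', hcdef, hj]
              norm_num
            · simp [hadj, hij, hFr, hFr', hlt, hij', hcdef, hpow, hj]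
              linarith
      refine (sum_le_sum fun u _ => sum_le_sum fun v _ => hpoint u v).trans ?_
      have hsum' := hsum
      simp only [sum_add_distrib, sum_sub_distrib, ← mul_sum] at hsum' ⊢
      have h2K : 2 * K * (4 * (1 / (8 * K)) * ∑ u, ∑ v, c u v) = ∑ u, ∑ v, c u v := by
        field_simp
        ring
      have h3 := mul_le_mul_of_nonneg_left hcut' (show 0 ≤ 2 * K by positivity)
      rw [h2K] at h3
      linarith

/-- Every connected graph with positive edge lengths has a spanning tree of low stretch: the
stretch of the edge `uv` is at most `y ^ (s u v + 2)`, where the exponents `s` are small on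
average. -/
theorem exists_lowStretch_tree {G : SimpleGraph V} (hG : G.Connected) {d : Sym2 V → ℝ}
    (hd : ∀ u v, G.Adj u v → 0 < d s(u, v)) {y K : ℝ} (hK : 1 < K) {R : ℕ} (hy : 4 * R + 2 ≤ y)
    (hR : (Fintype.card V : ℝ) + 1 ≤ (1 + 1 / (8 * K)) ^ R) [DecidableRel G.Adj] :
    ∃ T ≤ G, T.IsTree ∧ ∃ s : V → V → ℕ,
      (∀ u v, G.Adj u v → ∃ p : T.Walk u v, walkLen d p ≤ y ^ (s u v + 2) * d s(u, v)) ∧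
      ∑ u, ∑ v, (if G.Adj u v then K ^ s u v else 0) ≤
        2 * ∑ u, ∑ v, (if G.Adj u v then (1 : ℝ) else 0) := by
  classical
  have hy1 : 1 < y := by have : (0 : ℝ) ≤ R := by positivity
                         linarith
  obtain ⟨δ, hδ, hδd⟩ : ∃ δ > 0, ∀ u v, G.Adj u v → δ ≤ d s(u, v) := by
    rcases (univ.filter fun e : V × V => G.Adj e.1 e.2).eq_empty_or_nonempty with h | h
    · refine ⟨1, one_pos, fun u v huv => ?_⟩
      have : (u, v) ∈ univ.filter fun e : V × V => G.Adj e.1 e.2 := by simpa using huv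
      simp [h] at this
    · obtain ⟨e, he, hmin⟩ := exists_min_image _ (fun e : V × V => d s(e.1, e.2)) h
      exact ⟨d s(e.1, e.2), hd _ _ (mem_filter.1 he).2, fun u v huv =>
        hmin (u, v) (by simpa using huv)⟩
  have hex : ∀ e : Sym2 V, ∃ k, d e ≤ δ * y ^ k := by
    intro e
    obtain ⟨k, hk⟩ := pow_unbounded_of_one_lt (d e / δ) hy1
    exact ⟨k, by rw [div_lt_iff₀ hδ] at hk; linarith⟩
  set i : Sym2 V → ℕ := fun e => Nat.find (hex e)
  have hi : ∀ e, d e ≤ δ * y ^ i e := fun e => Nat.find_spec (hex e)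
  have hi' : ∀ u v, G.Adj u v → δ * y ^ i s(u, v) ≤ y * d s(u, v) := by
    intro u v huv
    rcases h : i s(u, v) with _ | k
    · have := hδd u v huv
      nlinarith
    · have : ¬ d s(u, v) ≤ δ * y ^ k := Nat.find_min (hex _) (by simp only [i] at h; omega)
      rw [pow_succ]
      nlinarith
  set M : ℝ := ∑ u, ∑ v, (if G.Adj u v then (1 : ℝ) else 0)
  obtain ⟨k, hk⟩ := pow_unbounded_of_one_lt M hK
  set j := univ.sup i + k + 1
  have hij : ∀ e, i e + k < j := fun e => by
    have := le_sup (f := i) (mem_univ e)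
    omega
  obtain ⟨F, hFG, hF, -, s, hs, hsum⟩ := exists_forest_after_rounds (G := G) hδ hK hy hR
    (fun u v _ => hi s(u, v)) j
  have hlt : ∀ e, i e < j := fun e => by have := hij e; omega
  have hsum' := hsum
  simp only [hlt, and_true] at hsum'
  have hnn : ∀ u v, 0 ≤ (if G.Adj u v then
      (if F.Reachable u v then K ^ s u v else 2 * K ^ (j - i s(u, v))) else 0) := by
    intro u v
    have : 0 < K := by linarith
    split_ifs <;> positivity
  have hreach : ∀ u v, G.Adj u v → F.Reachable u v := by
    intro u v huv
    by_contra hcon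
    have h1 : 2 * K ^ (j - i s(u, v)) ≤ 2 * M := by
      refine le_trans ?_ hsum'
      refine le_trans ?_ (single_le_sum (fun u _ => sum_nonneg fun v _ => hnn u v) (mem_univ u))
      refine le_trans ?_ (single_le_sum (fun v _ => hnn u v) (mem_univ v))
      simp [huv, hcon]
    have h2 : K ^ k ≤ K ^ (j - i s(u, v)) :=
      pow_le_pow_right₀ hK.le (by have := hij s(u, v); omega)
    linarith
  have hconn : F.Connected := by
    have := hG.nonempty
    refine ⟨fun u v => ?_⟩
    obtain ⟨p⟩ := hG.preconnected u v
    induction p with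
    | nil => rfl
    | cons h _ ih => exact (hreach _ _ h).trans ih
  refine ⟨F, hFG, ⟨hconn, hF⟩, s, ?_, ?_⟩
  · intro u v huv
    obtain ⟨p, hp⟩ := hs u v huv (hlt _) (hreach u v huv)
    refine ⟨p, hp.trans ?_⟩
    have h1 := hi' u v huv
    have h2 : 0 < y ^ (s u v + 1) := by positivity
    calc δ * y ^ (i s(u, v) + s u v + 1) = y ^ (s u v + 1) * (δ * y ^ i s(u, v)) := by ring
      _ ≤ y ^ (s u v + 1) * (y * d s(u, v)) := by gcongr
      _ = _ := by ring
  · refine le_trans (le_of_eq ?_) hsum'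
    refine sum_congr rfl fun u _ => sum_congr rfl fun v _ => ?_
    by_cases h : G.Adj u v
    · simp [h, hreach u v h]
    · simp [h]

end LowStretch

section TreeDistance

variable {V : Type*}

/-- `Separates T f u v`: deleting the edge `f` from `T` separates `u` from `v`. -/
def Separates (T : SimpleGraph V) (f : Sym2 V) (u v : V) : Prop :=
  ¬ (T.deleteEdges {f}).Reachable u v

/-- The squared difference of `x` along an unordered pair. -/
def sqDiff (x : V → ℝ) : Sym2 V → ℝ :=
  Sym2.lift ⟨fun u v => (x u - x v) ^ 2, fun u v => by ring⟩

@[simp]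
lemma sqDiff_mk (x : V → ℝ) (u v : V) : sqDiff x s(u, v) = (x u - x v) ^ 2 := rfl

lemma sqDiff_nonneg (x : V → ℝ) (e : Sym2 V) : 0 ≤ sqDiff x e := by
  induction e with | _ u v => exact sq_nonneg _

lemma Separates.mem_edges {T : SimpleGraph V} {f : Sym2 V} {u v : V} (h : Separates T f u v)
    (p : T.Walk u v) : f ∈ p.edges := by
  by_contra hf
  exact h ⟨p.toDeleteEdges {f} (by rintro e he rfl; exact hf he)⟩

lemma SimpleGraph.IsAcyclic.sep_of_mem_edges {T : SimpleGraph V} (hT : T.IsAcyclic) {u v : V}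
    {p : T.Walk u v} (hp : p.IsPath) {f : Sym2 V} (hf : f ∈ p.edges) : Separates T f u v := by
  intro hreach
  obtain ⟨q, hq, hfq⟩ : ∃ q : T.Walk u v, q.IsPath ∧ f ∉ q.edges := by
    obtain ⟨q, hq⟩ := hreach.exists_isPath
    refine ⟨q.mapLe (SimpleGraph.deleteEdges_le _), hq.mapLe _, fun h => ?_⟩
    rw [SimpleGraph.Walk.edges_mapLe_eq_edges] at h
    have := q.edges_subset_edgeSet h
    simp at this
  have : p = q := congrArg Subtype.val ((hT.subsingleton_path u v).elim ⟨p, hp⟩ ⟨q, hq⟩)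
  exact hfq (this ▸ hf)

variable [Fintype V]

open Classical in
/-- The edges of `T` that separate `u` from `v`. -/
def sepEdges (T : SimpleGraph V) (u v : V) : Finset (Sym2 V) :=
  {f | f ∈ T.edgeSet ∧ Separates T f u v}

lemma mem_sepEdges {T : SimpleGraph V} {u v : V} {f : Sym2 V} :
    f ∈ sepEdges T u v ↔ f ∈ T.edgeSet ∧ Separates T f u v := by
  simp [sepEdges]

/-- The distance in `T`, as the total length of the separating edges. -/
def treeDist (T : SimpleGraph V) (d : Sym2 V → ℝ) (u v : V) : ℝ :=
  ∑ f ∈ sepEdges T u v, d f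

lemma sepEdges_comm (T : SimpleGraph V) (u v : V) : sepEdges T u v = sepEdges T v u := by
  ext f
  simp only [mem_sepEdges, Separates, SimpleGraph.reachable_comm]

lemma treeDist_comm (T : SimpleGraph V) (d : Sym2 V → ℝ) (u v : V) :
    treeDist T d u v = treeDist T d v u := by
  rw [treeDist, sepEdges_comm, treeDist]

lemma treeDist_nonneg {T : SimpleGraph V} {d : Sym2 V → ℝ} (hd : ∀ e, 0 ≤ d e) (u v : V) :
    0 ≤ treeDist T d u v :=
  sum_nonneg fun e _ => hd e

lemma sum_toFinset_le_sum_map {α : Type*} [DecidableEq α] {d : α → ℝ} (hd : ∀ e, 0 ≤ d e)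
    (l : List α) : ∑ f ∈ l.toFinset, d f ≤ (l.map d).sum := by
  induction l with
  | nil => simp
  | cons a l ih =>
    rw [List.toFinset_cons, List.map_cons, List.sum_cons]
    by_cases ha : a ∈ l.toFinset
    · rw [insert_eq_of_mem ha]
      exact ih.trans (le_add_of_nonneg_left (hd a))
    · rw [sum_insert ha]
      gcongr

lemma treeDist_le_walkLen {T : SimpleGraph V} {d : Sym2 V → ℝ} (hd : ∀ e, 0 ≤ d e) {u v : V}
    (p : T.Walk u v) : treeDist T d u v ≤ walkLen d p := by
  classical
  calc treeDist T d u v ≤ ∑ f ∈ p.edges.toFinset, d f :=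
        sum_le_sum_of_subset_of_nonneg
          (fun f hf => List.mem_toFinset.2 ((mem_sepEdges.1 hf).2.mem_edges p)) fun f _ _ => hd f
    _ ≤ walkLen d p := by
        exact sum_toFinset_le_sum_map hd _

lemma sq_sub_le_treeDist_mul {T : SimpleGraph V} (hT : T.IsTree) {d ω : Sym2 V → ℝ}
    (hd : ∀ e, 0 ≤ d e) (hω : ∀ e, 0 ≤ ω e) (hdω : ∀ e ∈ T.edgeSet, d e * ω e = 1) (x : V → ℝ)
    (u v : V) :
    (x u - x v) ^ 2 ≤ treeDist T d u v * ∑ f ∈ sepEdges T u v, ω f * sqDiff x f := by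
  classical
  obtain ⟨p, hp⟩ := hT.1.exists_isPath u v
  have habs : ∀ {a b : V} (q : T.Walk a b),
      |x a - x b| ≤ (q.edges.map fun e => √(sqDiff x e)).sum := by
    intro a b q
    induction q with
    | nil => simp
    | @cons a b c h q ih =>
      simp only [SimpleGraph.Walk.edges_cons, List.map_cons, List.sum_cons, sqDiff_mk,
        Real.sqrt_sq_eq_abs]
      exact (abs_sub_le _ (x b) _).trans (by gcongr)
  have hsum : |x u - x v| ≤ ∑ f ∈ sepEdges T u v, √(sqDiff x f) := by
    refine (habs p).trans ?_
    rw [← List.sum_toFinset _ hp.isTrail.edges_nodup]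
    refine sum_le_sum_of_subset_of_nonneg (fun f hf => ?_) fun f _ _ => Real.sqrt_nonneg _
    rw [List.mem_toFinset] at hf
    exact mem_sepEdges.2 ⟨p.edges_subset_edgeSet hf, hT.2.sep_of_mem_edges hp hf⟩
  calc (x u - x v) ^ 2 = |x u - x v| ^ 2 := (sq_abs _).symm
    _ ≤ (∑ f ∈ sepEdges T u v, √(sqDiff x f)) ^ 2 := by gcongr
    _ = (∑ f ∈ sepEdges T u v, √(d f) * √(ω f * sqDiff x f)) ^ 2 := by
        congr 1
        refine sum_congr rfl fun f hf => ?_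
        rw [← Real.sqrt_mul (hd f), ← mul_assoc, hdω f (mem_sepEdges.1 hf).1, one_mul]
    _ ≤ (∑ f ∈ sepEdges T u v, √(d f) ^ 2) *
          ∑ f ∈ sepEdges T u v, √(ω f * sqDiff x f) ^ 2 := sum_mul_sq_le_sq_mul_sq _ _ _
    _ = _ := by
        congr 1
        · exact sum_congr rfl fun f _ => Real.sq_sqrt (hd f)
        · exact sum_congr rfl fun f _ => Real.sq_sqrt (mul_nonneg (hω f) (sqDiff_nonneg x f))

/-- If no edge separates both `u` from `a` and `b` from `v`, an edge separating one of the pairs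
and joining ends separates `u` from `v` or `a` from `b`. -/
lemma treeDist_add_treeDist_le {T : SimpleGraph V} {d : Sym2 V → ℝ} (hd : ∀ e, 0 ≤ d e)
    {u a b v : V} (h : ∀ f, Separates T f u a → ¬ Separates T f b v) :
    treeDist T d u a + treeDist T d b v ≤ treeDist T d u v + treeDist T d a b := by
  classical
  have hdisj : Disjoint (sepEdges T u a) (sepEdges T b v) :=
    disjoint_left.2 fun f hf hf' => h f (mem_sepEdges.1 hf).2 (mem_sepEdges.1 hf').2
  rw [treeDist, treeDist, ← sum_union hdisj]
  calc ∑ f ∈ sepEdges T u a ∪ sepEdges T b v, d f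
      ≤ ∑ f ∈ sepEdges T u v ∪ sepEdges T a b, d f := by
        refine sum_le_sum_of_subset_of_nonneg (fun f hf => ?_) fun f _ _ => hd f
        simp only [mem_union, mem_sepEdges] at hf ⊢
        by_contra! hcon
        have hfT : f ∈ T.edgeSet := by tauto
        have h1 : (T.deleteEdges {f}).Reachable u v := not_not.1 (hcon.1 hfT)
        have h2 : (T.deleteEdges {f}).Reachable a b := not_not.1 (hcon.2 hfT)
        rcases hf with hf | hf
        · have h3 : (T.deleteEdges {f}).Reachable b v := not_not.1 (h f hf.2)
          exact hf.2 ((h1.trans h3.symm).trans h2.symm)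
        · have h3 : (T.deleteEdges {f}).Reachable u a := not_not.1 fun h' => h f h' hf.2
          exact hf.2 ((h2.symm.trans h3.symm).trans h1)
    _ ≤ _ := by
        rw [treeDist, treeDist, ← sum_union_inter]
        exact le_add_of_nonneg_right (sum_nonneg fun f _ => hd f)

end TreeDistance

section Partition

variable {V : Type*}

lemma SimpleGraph.Connected.exists_parent {T : SimpleGraph V} (hT : T.Connected) (r : V) :
    ∃ (par : V → V) (rank : V → ℕ), ∀ v, v ≠ r → T.Adj v (par v) ∧ rank (par v) < rank v := by
  have : ∀ v, ∃ p, v ≠ r → T.Adj v p ∧ T.dist p r < T.dist v r := by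
    intro v
    obtain ⟨p, hp⟩ := hT.exists_walk_length_eq_dist v r
    cases p with
    | nil => exact ⟨r, fun h => (h rfl).elim⟩
    | @cons _ b _ hadj q =>
      refine ⟨b, fun _ => ⟨hadj, ?_⟩⟩
      rw [← hp, SimpleGraph.Walk.length_cons]
      exact Nat.lt_succ_of_le (SimpleGraph.dist_le q)
  choose par hpar using this
  exact ⟨par, fun v => T.dist v r, hpar⟩

/-- A class of a partition of a rooted tree is light if it is a single vertex, or has load at most
`θ` and becomes connected once a common ancestor `x` is added. -/
def IsLightClass (r : V) (par : V → V) (z : V → ℝ) (θ : ℝ) (P : V → Prop) : Prop :=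
  (∀ u a, P u → P a → u = a) ∨
    ((∀ s : Finset V, (∀ u ∈ s, P u) → ∑ u ∈ s, z u ≤ θ) ∧
      ∃ x, ∀ u, P u → u ≠ r ∧ (par u = x ∨ P (par u)))

/-- An intermediate state of the partition of a rooted tree into light classes: `Sum.inl x` labels
`x` and the vertices hanging below `x` that wait for their class, `Sum.inr k` labels the `k`-th
finished class. -/
structure PartialCut (r : V) (par : V → V) (z : V → ℝ) (θ : ℝ) (ℓ : V → V ⊕ ℕ)
    (N : ℕ) : Prop where
  root : ℓ r = Sum.inl r
  pending : ∀ v x, ℓ v = Sum.inl x →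
    ℓ x = Sum.inl x ∧ (v = x ∨ (v ≠ r ∧ ℓ (par v) = Sum.inl x))
  closed : ∀ v, v ≠ r → ℓ v = Sum.inl v → ℓ (par v) = Sum.inl (par v)
  lt : ∀ v k, ℓ v = Sum.inr k → k < N
  light : ∀ k, IsLightClass r par z θ fun v => ℓ v = Sum.inr k
  load : ∀ x (s : Finset V), (∀ v ∈ s, ℓ v = Sum.inl x ∧ v ≠ x) → ∑ v ∈ s, z v ≤ θ
  count : ∃ s : Finset V, (∀ v ∈ s, ∃ k, ℓ v = Sum.inr k) ∧ N * θ ≤ 3 * ∑ v ∈ s, z v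

variable {r : V} {par : V → V} {rank : V → ℕ} {z : V → ℝ} {θ : ℝ}

lemma PartialCut.merge {ℓ : V → V ⊕ ℕ} {N : ℕ} (hc : PartialCut r par z θ ℓ N)
    {v : V} (hv : ℓ v = Sum.inl v) (hvr : v ≠ r) (hpv : par v ≠ v)
    (hmax : ∀ u, u ≠ r → ℓ u = Sum.inl u → par u ≠ v)
    (hload : ∀ s : Finset V, (∀ u ∈ s, (ℓ u = Sum.inl v ∨ ℓ u = Sum.inl (par v)) ∧ u ≠ par v) →
      ∑ u ∈ s, z u ≤ θ) :
    ∃ ℓ', PartialCut r par z θ ℓ' N ∧ ∀ u, ℓ' u = Sum.inl u ↔ ℓ u = Sum.inl u ∧ u ≠ v := by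
  classical
  have hp := hc.closed v hvr hv
  refine ⟨fun u => if ℓ u = Sum.inl v then Sum.inl (par v) else ℓ u, ⟨?_, ?_, ?_, ?_, ?_, ?_, ?_⟩,
    ?_⟩
  · have := hc.root
    grind
  · intro u x hu
    have h1 := hc.pending u
    have h2 := hc.pending x
    grind
  · intro u hur hu
    have h1 := hc.closed u hur
    have h2 := hmax u hur
    grind
  · intro u k hu
    have := hc.lt u k
    grind
  · intro k
    convert hc.light k using 2 with u
    grind
  · intro x s hs
    by_cases hx : x = par v
    · subst hx
      refine hload s fun u hu => ?_
      have := hs u hu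
      grind
    · refine hc.load x s fun u hu => ?_
      have := hs u hu
      grind
  · obtain ⟨s, hs, h⟩ := hc.count
    refine ⟨s, fun u hu => ?_, h⟩
    obtain ⟨k, hk⟩ := hs u hu
    exact ⟨k, by grind⟩
  · intro u
    grind

lemma PartialCut.cut {ℓ : V → V ⊕ ℕ} {N : ℕ} (hc : PartialCut r par z θ ℓ N) {v : V}
    (hv : ℓ v = Sum.inl v) (hvr : v ≠ r) (hpv : par v ≠ v)
    (hmax : ∀ u, u ≠ r → ℓ u = Sum.inl u → par u ≠ v) {s : Finset V}
    (hs : ∀ u ∈ s, (ℓ u = Sum.inl v ∨ ℓ u = Sum.inl (par v)) ∧ u ≠ par v)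
    (hload : θ < ∑ u ∈ s, z u) :
    ∃ ℓ', PartialCut r par z θ ℓ' (N + 3) ∧
      ∀ u, ℓ' u = Sum.inl u ↔ ℓ u = Sum.inl u ∧ u ≠ v := by
  classical
  have hp := hc.closed v hvr hv
  refine ⟨fun u => if u = v then Sum.inr (N + 1) else if ℓ u = Sum.inl v then Sum.inr N else
    if ℓ u = Sum.inl (par v) ∧ u ≠ par v then Sum.inr (N + 2) else ℓ u,
    ⟨?_, ?_, ?_, ?_, ?_, ?_, ?_⟩, ?_⟩
  · have := hc.root
    grind
  · intro u x hu
    have huv : u ≠ v ∧ ℓ u ≠ Sum.inl v := by grind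
    have hux : ℓ u = Sum.inl x := by grind
    have hxp : x = par v → u = par v := by grind
    have hxv : x ≠ v := by grind
    have h1 := hc.pending u x hux
    grind (splits := 20)
  · intro u hur hu
    have h1 := hc.closed u hur
    have h2 := hmax u hur
    grind
  · intro u k hu
    have := hc.lt u k
    grind
  · intro k
    have hlt := fun u => hc.lt u
    rcases lt_trichotomy k (N + 1) with hk | rfl | hk
    · rcases Nat.lt_succ_iff_lt_or_eq.1 hk with hk | rfl
      · convert hc.light k using 2 with u
        grind
      · refine Or.inr ⟨fun s hs => hc.load v s fun u hu => ?_, v, fun u hu => ?_⟩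
        · have := hs u hu
          have := hlt u
          grind
        · have h1 := hlt u
          have h2 := hc.pending u v
          grind
    · refine Or.inl fun u a hu ha => ?_
      have h1 := hlt u
      have h2 := hlt a
      grind
    · by_cases hk2 : k = N + 2
      · subst hk2
        refine Or.inr ⟨fun s hs => hc.load (par v) s fun u hu => ?_, par v, fun u hu => ?_⟩
        · have := hs u hu
          have := hlt u
          grind
        · have h1 := hlt u
          have h2 := hc.pending u (par v)
          grind
      · refine Or.inl fun u a hu ha => ?_
        have h1 := hlt u
        grind
  · intro x s hs
    refine hc.load x s fun u hu => ?_
    have := hs u hu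
    grind
  · obtain ⟨s', hs', h⟩ := hc.count
    refine ⟨s' ∪ s, fun u hu => ?_, ?_⟩
    · rcases mem_union.1 hu with hu | hu
      · obtain ⟨k, hk⟩ := hs' u hu
        exact ⟨k, by grind⟩
      · have := hs u hu
        by_cases huv : u = v
        · exact ⟨N + 1, by grind⟩
        · by_cases h1 : ℓ u = Sum.inl v
          · exact ⟨N, by grind⟩
          · exact ⟨N + 2, by grind⟩
    · rw [sum_union]
      · push_cast
        linarith
      · refine disjoint_left.2 fun u hu hu' => ?_
        obtain ⟨k, hk⟩ := hs' u hu
        have := hs u hu'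
        grind
  · intro u
    grind

/-- A rooted tree with vertex loads `z` splits into `O(∑ z / θ + 1)` light classes. -/
theorem exists_light_partition [Fintype V] (hpar : ∀ v, v ≠ r → rank (par v) < rank v) (hz : ∀ v, 0 ≤ z v)
    (hθ : 0 < θ) :
    ∃ (N : ℕ) (ℓ : V → ℕ), N * θ ≤ 3 * ∑ v, z v + 2 * θ ∧ (∀ v, ℓ v < N) ∧
      ∀ k, IsLightClass r par z θ fun v => ℓ v = k := by
  classical
  have key : ∀ (n : ℕ) (ℓ : V → V ⊕ ℕ) (N : ℕ), PartialCut r par z θ ℓ N →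
      #{v | ℓ v = Sum.inl v ∧ v ≠ r} = n →
      ∃ (ℓ' : V → V ⊕ ℕ) (N' : ℕ), PartialCut r par z θ ℓ' N' ∧ ∀ v, ℓ' v = Sum.inl v → v = r := by
    intro n
    induction n with
    | zero =>
      intro ℓ N hc hn
      refine ⟨ℓ, N, hc, fun v hv => ?_⟩
      by_contra hvr
      exact Finset.notMem_empty v ((card_eq_zero.1 hn) ▸ (by simp [hv, hvr]))
    | succ n ih =>
      intro ℓ N hc hn
      obtain ⟨v, hvU, hv⟩ := exists_max_image ({v | ℓ v = Sum.inl v ∧ v ≠ r} : Finset V) rank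
        (card_pos.1 (by omega))
      rw [mem_filter] at hvU
      obtain ⟨-, hvl, hvr⟩ := hvU
      have hpv : par v ≠ v := fun h => by have := hpar v hvr; rw [h] at this; exact this.false
      have hmax : ∀ u, u ≠ r → ℓ u = Sum.inl u → par u ≠ v := by
        rintro u hur hu rfl
        have h1 := hv u (by simp [hu, hur])
        have h2 := hpar u hur
        omega
      obtain ⟨ℓ', N', hc', hl'⟩ : ∃ ℓ' N', PartialCut r par z θ ℓ' N' ∧
          ∀ u, ℓ' u = Sum.inl u ↔ ℓ u = Sum.inl u ∧ u ≠ v := by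
        by_cases hload : ∀ s : Finset V,
            (∀ u ∈ s, (ℓ u = Sum.inl v ∨ ℓ u = Sum.inl (par v)) ∧ u ≠ par v) → ∑ u ∈ s, z u ≤ θ
        · obtain ⟨ℓ', h⟩ := hc.merge hvl hvr hpv hmax hload
          exact ⟨ℓ', N, h⟩
        · push Not at hload
          obtain ⟨s, hs, hload⟩ := hload
          obtain ⟨ℓ', h⟩ := hc.cut hvl hvr hpv hmax hs hload
          exact ⟨ℓ', _, h⟩
      refine ih ℓ' N' hc' ?_
      have : ({u | ℓ' u = Sum.inl u ∧ u ≠ r} : Finset V) =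
          ({u | ℓ u = Sum.inl u ∧ u ≠ r} : Finset V).erase v := by
        ext u
        simp only [mem_filter, mem_univ, true_and, mem_erase, hl']
        tauto
      rw [this, card_erase_of_mem (by simp [hvl, hvr]), hn, Nat.add_sub_cancel]
  obtain ⟨ℓ, N, hc, hU⟩ := key _ Sum.inl 0 ⟨rfl, fun v x h => ⟨rfl, Or.inl (Sum.inl.inj h)⟩,
    fun _ _ _ => rfl, by simp, fun k => Or.inl (by simp), fun x s hs => by
      have : s = ∅ := eq_empty_of_forall_notMem fun v hv => (hs v hv).2 (Sum.inl.inj (hs v hv).1)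
      simp [this, hθ.le], ⟨∅, by simp⟩⟩ rfl
  have hinl : ∀ v x, ℓ v = Sum.inl x → x = r := fun v x h => hU x (hc.pending v x h).1
  refine ⟨N + 2, fun v => if v = r then N + 1 else Sum.elim (fun _ => N) id (ℓ v), ?_, ?_, ?_⟩
  · obtain ⟨s, -, hs⟩ := hc.count
    have := sum_le_univ_sum_of_nonneg (s := s) hz
    push_cast
    linarith
  · intro v
    have := hc.lt v
    rcases h : ℓ v with x | k <;> grind
  · intro k
    have hlt := fun u => hc.lt u
    have hval : ∀ v, v ≠ r → (ℓ v = Sum.inl r ∧ Sum.elim (fun _ => N) id (ℓ v) = N) ∨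
        ∃ j < N, ℓ v = Sum.inr j ∧ Sum.elim (fun _ => N) id (ℓ v) = j := by
      intro v hv
      rcases h : ℓ v with x | j
      · exact Or.inl ⟨by rw [hinl v x h], rfl⟩
      · exact Or.inr ⟨j, hlt v j h, rfl, rfl⟩
    have hroot := hc.root
    rcases lt_trichotomy k N with hk | rfl | hk
    · convert hc.light k using 2 with v
      have := hval v
      grind
    · refine Or.inr ⟨fun s hs => hc.load r s fun u hu => ?_, r, fun u hu => ?_⟩
      · have h1 := hs u hu
        have h2 := hval u
        grind
      · have h1 := hval u
        have h2 := hval (par u)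
        have h3 := hc.pending u r
        grind
    · refine Or.inl fun u a hu ha => ?_
      have h1 := hval u
      have h2 := hval a
      grind

lemma IsLightClass.exists_of_separates {T : SimpleGraph V} {P : V → Prop}
    (hP : IsLightClass r par z θ P)
    (hpar : ∀ v, v ≠ r → T.Adj v (par v) ∧ rank (par v) < rank v) {u a : V} (hu : P u) (ha : P a)
    {f : Sym2 V} (hf : Separates T f u a) : ∃ y, (P y ∧ y ≠ r) ∧ f = s(y, par y) := by
  rcases hP with hP | ⟨-, x, hx⟩
  · exact (hf (hP u a hu ha ▸ SimpleGraph.Reachable.refl _)).elim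
  · by_contra! hcon
    have key : ∀ (n : ℕ) (y : V), rank y = n → P y → (T.deleteEdges {f}).Reachable y x := by
      intro n
      induction n using Nat.strong_induction_on with
      | _ n ih =>
        rintro y rfl hy
        obtain ⟨hyr, hpy⟩ := hx y hy
        have hadj : (T.deleteEdges {f}).Adj y (par y) :=
          SimpleGraph.deleteEdges_adj.2 ⟨(hpar y hyr).1, fun h => hcon y ⟨hy, hyr⟩ h.symm⟩
        refine hadj.reachable.trans ?_
        rcases hpy with hpy | hpy
        · rw [hpy]
        · exact ih _ (hpar y hyr).2 _ rfl hpy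
    exact hf ((key _ u rfl hu).trans (key _ a rfl ha).symm)

lemma parent_edge_injOn (hpar : ∀ v, v ≠ r → rank (par v) < rank v) :
    Set.InjOn (fun y => s(y, par y)) {y | y ≠ r} := by
  intro y hy y' hy' h
  rcases Sym2.eq_iff.1 h with h | ⟨h1, h2⟩
  · exact h.1
  · have h3 := hpar y hy
    have h4 := hpar y' hy'
    rw [h2] at h3
    rw [← h1] at h4
    omega

end Partition

section Sparsify

lemma sum_mul_comp_le {ι κ : Type*} [Fintype ι] [DecidableEq κ] {ℓ : ι → κ} {s : Finset κ}
    (hℓ : ∀ i, ℓ i ∈ s) {z : ι → ℝ} {E : κ → ℝ} (hE : ∀ k, 0 ≤ E k) {θ : ℝ}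
    (h : ∀ k ∈ s, E k ≠ 0 → ∑ i with ℓ i = k, z i ≤ θ) :
    ∑ i, z i * E (ℓ i) ≤ θ * ∑ k ∈ s, E k := by
  rw [← sum_fiberwise_of_maps_to (fun i _ => hℓ i), mul_sum]
  refine sum_le_sum fun k hk => ?_
  rw [sum_congr rfl (g := fun i => z i * E k) (fun i hi => by rw [(mem_filter.1 hi).2]), ← sum_mul]
  rcases eq_or_ne (E k) 0 with h0 | h0
  · simp [h0]
  · exact mul_le_mul_of_nonneg_right (h k hk h0) (hE k)

lemma sum_comp_le_of_injOn {ι α : Type*} [Fintype α] {s : Finset ι} {ρ : ι → α}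
    (hρ : Set.InjOn ρ s) {F : α → ℝ} (hF : ∀ a, 0 ≤ F a) : ∑ i ∈ s, F (ρ i) ≤ ∑ a, F a := by
  classical
  rw [← sum_image hρ]
  exact sum_le_univ_sum_of_nonneg hF

variable {V : Type*} [Fintype V]

lemma IsLightClass.sq_sub_le {w : V → V → ℝ} (hw : IsWeighting w) {T : SimpleGraph V}
    (hT : T.IsTree) (hTw : ∀ u v, T.Adj u v → 0 < w u v) {d : Sym2 V → ℝ} (hd : ∀ e, 0 ≤ d e)
    (hdw : ∀ u v, 0 < w u v → w u v * d s(u, v) = 1) {r : V} {par : V → V} {rank : V → ℕ}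
    (hpar : ∀ v, v ≠ r → T.Adj v (par v) ∧ rank (par v) < rank v) {z : V → ℝ} {θ : ℝ}
    {P : V → Prop} [DecidablePred fun y => P y ∧ y ≠ r] (hP : IsLightClass r par z θ P) {u a : V}
    (hu : P u) (ha : P a) (x : V → ℝ) :
    (x u - x a) ^ 2 ≤
      treeDist T d u a * ∑ y with P y ∧ y ≠ r, w y (par y) * (x y - x (par y)) ^ 2 := by
  classical
  set ω : Sym2 V → ℝ := Sym2.lift ⟨w, hw.symm⟩ with hωdef
  have hω : ∀ e, 0 ≤ ω e := fun e => by induction e with | _ u v => exact hw.nonneg u v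
  refine (sq_sub_le_treeDist_mul hT hd hω (fun e he => ?_) x u a).trans ?_
  · induction e with
    | _ u v => exact (mul_comm _ _).trans (hdw u v (hTw u v he))
  · refine mul_le_mul_of_nonneg_left ?_ (treeDist_nonneg hd u a)
    have hinj : Set.InjOn (fun y => s(y, par y)) ({y | P y ∧ y ≠ r} : Finset V) :=
      (parent_edge_injOn fun v hv => (hpar v hv).2).mono fun y hy => by
        simp only [coe_filter, mem_univ, true_and, Set.mem_ofPred_eq] at hy
        exact hy.2
    calc ∑ f ∈ sepEdges T u a, ω f * sqDiff x f
        ≤ ∑ f ∈ ({y | P y ∧ y ≠ r} : Finset V).image fun y => s(y, par y), ω f * sqDiff x f := by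
          refine sum_le_sum_of_subset_of_nonneg (fun f hf => ?_)
            fun f _ _ => mul_nonneg (hω f) (sqDiff_nonneg x f)
          obtain ⟨y, hy, rfl⟩ := hP.exists_of_separates hpar hu ha (mem_sepEdges.1 hf).2
          exact mem_image_of_mem _ (by simpa using hy)
      _ = _ := sum_image hinj

/-- Minimizing representatives of the pairs of classes joined by an edge. -/
lemma exists_bundle_representative [Nonempty V] (w : V → V → ℝ) (ℓ : V → ℕ) (D : V → V → ℝ) :
    ∃ ρ : ℕ × ℕ → V × V, ∀ u v, 0 < w u v →
      ℓ (ρ (ℓ u, ℓ v)).1 = ℓ u ∧ ℓ (ρ (ℓ u, ℓ v)).2 = ℓ v ∧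
        0 < w (ρ (ℓ u, ℓ v)).1 (ρ (ℓ u, ℓ v)).2 ∧
          D (ρ (ℓ u, ℓ v)).1 (ρ (ℓ u, ℓ v)).2 ≤ D u v := by
  classical
  have : ∀ q : ℕ × ℕ, ∃ p : V × V, ∀ u v, 0 < w u v → (ℓ u, ℓ v) = q →
      ℓ p.1 = ℓ u ∧ ℓ p.2 = ℓ v ∧ 0 < w p.1 p.2 ∧ D p.1 p.2 ≤ D u v := by
    intro q
    by_cases h : ∃ p : V × V, 0 < w p.1 p.2 ∧ (ℓ p.1, ℓ p.2) = q
    · obtain ⟨p₀, hp₀⟩ := h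
      obtain ⟨p, hp, hmin⟩ := exists_min_image
        ({p | 0 < w p.1 p.2 ∧ (ℓ p.1, ℓ p.2) = q} : Finset (V × V)) (fun p => D p.1 p.2)
        ⟨p₀, by simpa using hp₀⟩
      rw [mem_filter] at hp
      refine ⟨p, fun u v huv hq => ?_⟩
      have h1 := hp.2.2.trans hq.symm
      exact ⟨congrArg Prod.fst h1, congrArg Prod.snd h1, hp.2.1,
        hmin (u, v) (by simp [huv, hq])⟩
    · exact ⟨Classical.arbitrary _, fun u v huv hq => (h ⟨(u, v), huv, hq⟩).elim⟩
  choose ρ hρ using this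
  exact ⟨ρ, fun u v huv => hρ _ u v huv rfl⟩

lemma IsLightClass.subsingleton_or_load_le {r : V} {par : V → V} {z : V → ℝ} {θ : ℝ}
    {P : V → Prop} [DecidablePred P] (hP : IsLightClass r par z θ P) :
    (∀ u a, P u → P a → u = a) ∨ ∑ y with P y, z y ≤ θ :=
  hP.imp_right fun h => h.1 _ fun _ hu => (mem_filter.1 hu).2

/-- A tree together with few representative edges spectrally approximates a weighting, up to a
factor governed by the total stretch divided by the number of classes. -/
theorem exists_sparse_approximation {w : V → V → ℝ} (hw : IsWeighting w) {T : SimpleGraph V}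
    (hT : T.IsTree) (hTw : ∀ u v, T.Adj u v → 0 < w u v) {d : Sym2 V → ℝ} (hd : ∀ e, 0 ≤ d e)
    (hdw : ∀ u v, 0 < w u v → w u v * d s(u, v) = 1) {θ : ℝ} (hθ : 0 < θ) :
    ∃ (N : ℕ) (S : Set (Sym2 V)),
      N * θ ≤ 3 * ∑ u, ∑ v, w u v * (treeDist T d u v + d s(u, v)) + 2 * θ ∧
      S ⊆ edgeSetW w ∧ S.ncard ≤ N ^ 2 ∧
      ∀ x : V → ℝ, ∑ u, ∑ v, w u v * (x u - x v) ^ 2 ≤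
        (15 * θ + 3) * ∑ u, ∑ v, restrictW w (T.edgeSet ∪ S) u v * (x u - x v) ^ 2 := by
  classical
  obtain ⟨r⟩ := hT.1.nonempty
  have : Nonempty V := ⟨r⟩
  obtain ⟨par, rank, hpar⟩ := hT.1.exists_parent r
  set D : V → V → ℝ := fun u v => treeDist T d u v + d s(u, v) with hD
  set g : V → V → ℝ := fun u v => w u v * D u v with hg
  have hD0 : ∀ u v, 0 ≤ D u v := fun u v => add_nonneg (treeDist_nonneg hd u v) (hd _)
  have hg0 : ∀ u v, 0 ≤ g u v := fun u v => mul_nonneg (hw.nonneg u v) (hD0 u v)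
  have hgsymm : ∀ u v, g u v = g v u := fun u v => by
    simp only [hg, hD, hw.symm u v, treeDist_comm T d u v, Sym2.eq_swap (a := u)]
  obtain ⟨N, ℓ, hN, hℓN, hlight⟩ := exists_light_partition (z := fun u => ∑ v, g u v)
    (fun v hv => (hpar v hv).2) (fun u => sum_nonneg fun v _ => hg0 u v) hθ
  obtain ⟨ρ, hρ⟩ := exists_bundle_representative w ℓ D
  set S : Set (Sym2 V) := {e | ∃ u v, 0 < w u v ∧ e = s((ρ (ℓ u, ℓ v)).1, (ρ (ℓ u, ℓ v)).2)}
    with hS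
  refine ⟨N, S, hN, ?_, ?_, fun x => ?_⟩
  · rintro e ⟨u, v, huv, rfl⟩
    have h := (hρ u v huv).2.2.1
    exact ⟨_, _, rfl, fun heq => by rw [heq, hw.diag] at h; exact h.false, h⟩
  · have hsub : S ⊆ ((range N ×ˢ range N).image fun q => s((ρ q).1, (ρ q).2) : Finset (Sym2 V)) := by
      rintro e ⟨u, v, -, rfl⟩
      rw [mem_coe, mem_image]
      exact ⟨(ℓ u, ℓ v), by simp [hℓN], rfl⟩
    calc S.ncard ≤ _ := Set.ncard_le_ncard hsub (Finset.finite_toSet _)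
      _ ≤ #(range N ×ˢ range N) := by rw [Set.ncard_coe_finset]; exact card_image_le
      _ = N ^ 2 := by simp [sq]
  set φ : V → V → ℝ := fun u v => w u v * (x u - x v) ^ 2 with hφ
  have hφ0 : ∀ u v, 0 ≤ φ u v := fun u v => mul_nonneg (hw.nonneg u v) (sq_nonneg _)
  set Q : ℝ := ∑ p : V × V, restrictW w (T.edgeSet ∪ S) p.1 p.2 * (x p.1 - x p.2) ^ 2 with hQ
  have hQterm : ∀ p : V × V, 0 ≤ restrictW w (T.edgeSet ∪ S) p.1 p.2 * (x p.1 - x p.2) ^ 2 := by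
    intro p
    refine mul_nonneg ?_ (sq_nonneg _)
    unfold restrictW
    split_ifs
    exacts [hw.nonneg _ _, le_rfl]
  set load : ℕ → ℝ := fun k => ∑ y with ℓ y = k, ∑ v, g y v with hloaddef
  set En : ℕ → ℝ := fun k => if load k ≤ θ then ∑ y with ℓ y = k ∧ y ≠ r, φ y (par y) else 0
    with hEn
  set Φ : ℕ × ℕ → ℝ := fun q => if ∃ u v, 0 < w u v ∧ (ℓ u, ℓ v) = q
    then φ (ρ q).1 (ρ q).2 else 0 with hΦ
  set γ : V × V → ℝ := fun p => if load (ℓ p.1) ≤ θ ∨ load (ℓ p.2) ≤ θ then g p.1 p.2 else 1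
    with hγ
  have hEn0 : ∀ k, 0 ≤ En k := fun k => by
    simp only [hEn]
    split_ifs
    exacts [sum_nonneg fun y _ => hφ0 _ _, le_rfl]
  have hΦ0 : ∀ q, 0 ≤ Φ q := fun q => by
    simp only [hΦ]
    split_ifs
    exacts [hφ0 _ _, le_rfl]
  have hγ0 : ∀ p, 0 ≤ γ p := fun p => by
    simp only [hγ]
    split_ifs
    exacts [hg0 _ _, zero_le_one]
  have hclass : ∀ u a, ℓ u = ℓ a → (x u - x a) ^ 2 ≤ treeDist T d u a * En (ℓ u) := by
    intro u a hua
    rcases eq_or_ne u a with rfl | hne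
    · simpa using mul_nonneg (treeDist_nonneg hd u u) (hEn0 _)
    · have hload : load (ℓ u) ≤ θ :=
        (hlight (ℓ u)).subsingleton_or_load_le.resolve_left fun h => hne (h u a rfl hua.symm)
      simp only [hEn, if_pos hload]
      exact (hlight (ℓ u)).sq_sub_le hw hT hTw hd hdw hpar rfl hua.symm x
  have hedge : ∀ u v, φ u v ≤ 6 * (g u v * En (ℓ u) + g u v * En (ℓ v)) +
      3 * (γ (u, v) * Φ (ℓ u, ℓ v)) := by
    intro u v
    have hg1 := mul_nonneg (hg0 u v) (hEn0 (ℓ u))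
    have hg2 := mul_nonneg (hg0 u v) (hEn0 (ℓ v))
    have hγΦ := mul_nonneg (hγ0 (u, v)) (hΦ0 (ℓ u, ℓ v))
    rcases (hw.nonneg u v).eq_or_lt with h0 | hpos
    · have : φ u v = 0 := by simp [hφ, ← h0]
      linarith
    by_cases huv : ℓ u = ℓ v
    · have : φ u v ≤ g u v * En (ℓ u) :=
        calc w u v * (x u - x v) ^ 2 ≤ w u v * (treeDist T d u v * En (ℓ u)) :=
              mul_le_mul_of_nonneg_left (hclass u v huv) hpos.le
          _ ≤ w u v * (D u v * En (ℓ u)) := by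
              gcongr
              · exact hEn0 _
              · exact le_add_of_nonneg_right (hd _)
          _ = _ := (mul_assoc _ _ _).symm
      linarith
    obtain ⟨ha, hb, hab, hmin⟩ := hρ u v hpos
    have hΦval : Φ (ℓ u, ℓ v) = φ (ρ (ℓ u, ℓ v)).1 (ρ (ℓ u, ℓ v)).2 := if_pos ⟨u, v, hpos, rfl⟩
    generalize (ρ (ℓ u, ℓ v)).1 = a at *
    generalize (ρ (ℓ u, ℓ v)).2 = b at *
    by_cases hheavy : load (ℓ u) ≤ θ ∨ load (ℓ v) ≤ θ
    · have hγval : γ (u, v) = g u v := if_pos hheavy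
      have hsep : ∀ f, Separates T f u a → ¬ Separates T f b v := by
        intro f h1 h2
        obtain ⟨y, hy, rfl⟩ := (hlight (ℓ u)).exists_of_separates hpar rfl ha h1
        obtain ⟨y', hy', h⟩ := (hlight (ℓ v)).exists_of_separates hpar hb rfl h2
        have := parent_edge_injOn (fun v hv => (hpar v hv).2) hy.2 hy'.2 h
        exact huv (hy.1.symm.trans ((congrArg ℓ this).trans hy'.1))
      have htd := treeDist_add_treeDist_le hd hsep
      have h1 := hclass u a ha.symm
      have h2 := hclass b v hb
      rw [hb] at h2
      have hta := treeDist_nonneg (T := T) hd u a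
      have htb := treeDist_nonneg (T := T) hd b v
      have hdab : (x a - x b) ^ 2 = d s(a, b) * φ a b := by
        simp only [hφ]
        rw [← mul_assoc, mul_comm (d _), hdw a b hab, one_mul]
      have hDab : d s(a, b) ≤ D u v :=
        (le_add_of_nonneg_left (treeDist_nonneg hd a b)).trans hmin
      have h2D : treeDist T d u v + treeDist T d a b ≤ 2 * D u v := by
        have h3 : treeDist T d u v ≤ D u v := le_add_of_nonneg_right (hd _)
        have h4 : treeDist T d a b ≤ D a b := le_add_of_nonneg_right (hd _)
        linarith
      have hsq : (x u - x v) ^ 2 ≤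
          3 * ((x u - x a) ^ 2 + (x a - x b) ^ 2 + (x b - x v) ^ 2) := by
        nlinarith [sq_nonneg (x u - x a - (x a - x b)), sq_nonneg (x a - x b - (x b - x v)),
          sq_nonneg (x u - x a - (x b - x v))]
      have h5 : treeDist T d u a * En (ℓ u) ≤ 2 * D u v * En (ℓ u) :=
        mul_le_mul_of_nonneg_right (by linarith) (hEn0 _)
      have h6 : treeDist T d b v * En (ℓ v) ≤ 2 * D u v * En (ℓ v) :=
        mul_le_mul_of_nonneg_right (by linarith) (hEn0 _)
      have h7 : d s(a, b) * φ a b ≤ D u v * φ a b := mul_le_mul_of_nonneg_right hDab (hφ0 _ _)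
      rw [hγval, hΦval]
      calc φ u v ≤ w u v * (3 * (2 * D u v * En (ℓ u) + D u v * φ a b + 2 * D u v * En (ℓ v))) :=
            mul_le_mul_of_nonneg_left (by linarith) hpos.le
        _ = _ := by simp only [hg]; ring
    · have hγval : γ (u, v) = 1 := if_neg hheavy
      push Not at hheavy
      have hua : a = u := ((hlight (ℓ u)).subsingleton_or_load_le.resolve_right
        hheavy.1.not_ge) a u ha rfl
      have hvb : b = v := ((hlight (ℓ v)).subsingleton_or_load_le.resolve_right
        hheavy.2.not_ge) b v hb rfl
      subst hua hvb
      rw [hγval, hΦval, one_mul]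
      linarith [hφ0 a b]
  have htree : ∑ k ∈ range N, En k ≤ Q := by
    calc ∑ k ∈ range N, En k
        ≤ ∑ k ∈ range N, ∑ y ∈ ({y | y ≠ r} : Finset V) with ℓ y = k, φ y (par y) := by
          refine sum_le_sum fun k _ => ?_
          rw [filter_filter]
          simp only [hEn]
          split_ifs
          · simp only [and_comm, le_refl]
          · exact sum_nonneg fun y _ => hφ0 _ _
      _ = ∑ y with y ≠ r, φ y (par y) :=
          sum_fiberwise_of_maps_to (fun y _ => mem_range.2 (hℓN y)) _
      _ = ∑ y with y ≠ r, restrictW w (T.edgeSet ∪ S) y (par y) * (x y - x (par y)) ^ 2 := by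
          refine sum_congr rfl fun y hy => ?_
          have : s(y, par y) ∈ T.edgeSet := (hpar y (mem_filter.1 hy).2).1
          rw [restrictW, if_pos (Set.mem_union_left _ this)]
      _ ≤ Q := sum_comp_le_of_injOn (ρ := fun y => (y, par y))
          (fun y _ y' _ h => congrArg Prod.fst h) hQterm
  have hbundle : ∑ q ∈ range N ×ˢ range N, Φ q ≤ Q := by
    simp only [hΦ]
    rw [← sum_filter]
    calc _ = ∑ q ∈ range N ×ˢ range N with ∃ u v, 0 < w u v ∧ (ℓ u, ℓ v) = q,
          restrictW w (T.edgeSet ∪ S) (ρ q).1 (ρ q).2 * (x (ρ q).1 - x (ρ q).2) ^ 2 := by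
          refine sum_congr rfl fun q hq => ?_
          obtain ⟨-, u, v, huv, rfl⟩ := mem_filter.1 hq
          have hmem : s((ρ (ℓ u, ℓ v)).1, (ρ (ℓ u, ℓ v)).2) ∈ S := ⟨u, v, huv, rfl⟩
          rw [restrictW, if_pos (Set.mem_union_right _ hmem)]
      _ ≤ Q := by
          refine sum_comp_le_of_injOn (ρ := ρ) (fun q hq q' hq' h => ?_) hQterm
          obtain ⟨-, u, v, huv, rfl⟩ := mem_filter.1 hq
          obtain ⟨-, u', v', huv', rfl⟩ := mem_filter.1 hq'
          have h1 := hρ u v huv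
          have h2 := hρ u' v' huv'
          rw [h] at h1
          exact Prod.ext (h1.1.symm.trans h2.1) (h1.2.1.symm.trans h2.2.1)
  have hfirst : ∑ u, ∑ v, g u v * En (ℓ u) ≤ θ * ∑ k ∈ range N, En k := by
    simp only [← sum_mul]
    refine sum_mul_comp_le (fun u => mem_range.2 (hℓN u)) hEn0 fun k _ hk => ?_
    by_contra h
    exact hk (if_neg h)
  have hsecond : ∑ u, ∑ v, g u v * En (ℓ v) ≤ θ * ∑ k ∈ range N, En k := by
    rw [sum_comm]
    simpa only [hgsymm] using hfirst
  have hthird : ∑ u, ∑ v, γ (u, v) * Φ (ℓ u, ℓ v) ≤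
      (θ + 1) * ∑ q ∈ range N ×ˢ range N, Φ q := by
    rw [← Fintype.sum_prod_type' (f := fun u v => γ (u, v) * Φ (ℓ u, ℓ v))]
    refine sum_mul_comp_le (ℓ := fun p : V × V => (ℓ p.1, ℓ p.2)) (by simp [hℓN]) hΦ0 ?_
    rintro ⟨k, l⟩ - -
    have hfil : ({p | (ℓ p.1, ℓ p.2) = (k, l)} : Finset (V × V)) =
        ({u | ℓ u = k} : Finset V) ×ˢ ({v | ℓ v = l} : Finset V) := by
      ext p; simp
    rw [hfil]
    by_cases h : load k ≤ θ ∨ load l ≤ θ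
    · have hval : ∀ p ∈ ({u | ℓ u = k} : Finset V) ×ˢ ({v | ℓ v = l} : Finset V),
          γ p = g p.1 p.2 := by
        intro p hp
        simp only [mem_product, mem_filter, mem_univ, true_and] at hp
        simp only [hγ, hp.1, hp.2, if_pos h]
      rw [sum_congr rfl hval]
      refine le_trans ?_ (le_add_of_nonneg_right zero_le_one)
      rcases h with h | h
      · rw [sum_product]
        exact (sum_le_sum fun u _ => sum_le_univ_sum_of_nonneg (hg0 u)).trans h
      · rw [sum_product_right]
        refine (sum_le_sum fun v _ => ?_).trans h
        simp only [hgsymm _ v]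
        exact sum_le_univ_sum_of_nonneg (hg0 v)
    · have hval : ∀ p ∈ ({u | ℓ u = k} : Finset V) ×ˢ ({v | ℓ v = l} : Finset V), γ p = 1 := by
        intro p hp
        simp only [mem_product, mem_filter, mem_univ, true_and] at hp
        simp only [hγ, hp.1, hp.2, if_neg h]
      push Not at h
      have hc : ∀ j, θ < load j → #{u | ℓ u = j} ≤ 1 := fun j hj =>
        card_le_one.2 fun u hu a ha => ((hlight j).subsingleton_or_load_le.resolve_right
          hj.not_ge) u a (mem_filter.1 hu).2 (mem_filter.1 ha).2
      rw [sum_congr rfl hval, sum_const, card_product, nsmul_eq_mul, mul_one]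
      have : (#{u | ℓ u = k} * #{v | ℓ v = l} : ℕ) ≤ 1 := Nat.mul_le_mul (hc k h.1) (hc l h.2)
      have : ((#{u | ℓ u = k} * #{v | ℓ v = l} : ℕ) : ℝ) ≤ 1 := by exact_mod_cast this
      linarith
  have hQval : Q = ∑ u, ∑ v, restrictW w (T.edgeSet ∪ S) u v * (x u - x v) ^ 2 :=
    Fintype.sum_prod_type _
  rw [← hQval]
  calc ∑ u, ∑ v, φ u v ≤ ∑ u, ∑ v, (6 * (g u v * En (ℓ u) + g u v * En (ℓ v)) +
        3 * (γ (u, v) * Φ (ℓ u, ℓ v))) := by gcongr; exact hedge _ _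
    _ = 6 * (∑ u, ∑ v, g u v * En (ℓ u) + ∑ u, ∑ v, g u v * En (ℓ v)) +
        3 * ∑ u, ∑ v, γ (u, v) * Φ (ℓ u, ℓ v) := by
        simp only [sum_add_distrib, ← mul_sum]
    _ ≤ 6 * (θ * Q + θ * Q) + 3 * ((θ + 1) * Q) := by
        gcongr ?_ * (?_ + ?_) + ?_ * ?_
        · exact hfirst.trans (by gcongr)
        · exact hsecond.trans (by gcongr)
        · exact hthird.trans (by gcongr)
    _ = (15 * θ + 3) * Q := by ring

end Sparsify

section Laplacian

variable {V : Type*} {w : V → V → ℝ}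

lemma IsWeighting.isWeighting_restrictW (hw : IsWeighting w) (F : Set (Sym2 V)) :
    IsWeighting (restrictW w F) where
  symm u v := by rw [restrictW, restrictW, Sym2.eq_swap, hw.symm u v]
  nonneg u v := by
    unfold restrictW
    split_ifs
    exacts [hw.nonneg u v, le_rfl]
  diag v := by simp [restrictW, hw.diag]

lemma restrictW_le (hw : IsWeighting w) (F : Set (Sym2 V)) (u v : V) : restrictW w F u v ≤ w u v := by
  unfold restrictW
  split_ifs
  exacts [le_rfl, hw.nonneg u v]

lemma IsWeighting.adj_iff (hw : IsWeighting w) {u v : V} :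
    (SimpleGraph.fromEdgeSet (edgeSetW w)).Adj u v ↔ 0 < w u v := by
  rw [SimpleGraph.fromEdgeSet_adj]
  constructor
  · rintro ⟨⟨a, b, h, -, hab⟩, -⟩
    rcases Sym2.eq_iff.1 h with ⟨rfl, rfl⟩ | ⟨rfl, rfl⟩
    exacts [hab, hw.symm _ _ ▸ hab]
  · intro h
    have hne : u ≠ v := by rintro rfl; exact h.ne' (hw.diag u)
    exact ⟨⟨u, v, rfl, hne, h⟩, hne⟩

lemma edgeSet_fromEdgeSet_edgeSetW (w : V → V → ℝ) :
    (SimpleGraph.fromEdgeSet (edgeSetW w)).edgeSet = edgeSetW w := by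
  rw [SimpleGraph.edgeSet_fromEdgeSet, sdiff_eq_left, Set.disjoint_left]
  rintro _ ⟨u, v, rfl, hne, -⟩ h
  exact hne (by simpa using h)

lemma dotProduct_lap_mulVec [Fintype V] [DecidableEq V] (hw : IsWeighting w) (x : V → ℝ) :
    x ⬝ᵥ (lap w *ᵥ x) = (∑ u, ∑ v, w u v * (x u - x v) ^ 2) / 2 := by
  have hrow : ∀ u, (lap w *ᵥ x) u = ∑ v, w u v * (x u - x v) := by
    intro u
    have : ∀ v, lap w u v * x v = (if u = v then (∑ y, w u y) * x u else 0) - w u v * x v := by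
      intro v
      unfold lap
      split_ifs with h
      · subst h
        simp [hw.diag]
      · ring
    simp only [mulVec, dotProduct, this, sum_sub_distrib, sum_ite_eq, mem_univ, if_true, mul_sub,
      sum_mul]
  have hswap : ∑ u, ∑ v, w u v * (x u - x v) * x v = -∑ u, ∑ v, w u v * (x u - x v) * x u := by
    rw [sum_comm, ← sum_neg_distrib]
    refine sum_congr rfl fun u _ => ?_
    rw [← sum_neg_distrib]
    exact sum_congr rfl fun v _ => by rw [hw.symm v u]; ring
  have hsq : ∑ u, ∑ v, w u v * (x u - x v) ^ 2 =
      ∑ u, ∑ v, w u v * (x u - x v) * x u - ∑ u, ∑ v, w u v * (x u - x v) * x v := by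
    simp only [← sum_sub_distrib]
    exact sum_congr rfl fun u _ => sum_congr rfl fun v _ => by ring
  have hdot : x ⬝ᵥ (lap w *ᵥ x) = ∑ u, ∑ v, w u v * (x u - x v) * x u := by
    simp only [dotProduct, hrow, mul_sum]
    exact sum_congr rfl fun u _ => sum_congr rfl fun v _ => by ring
  rw [hsq, hswap, hdot]
  ring

lemma sum_sum_adj_eq [Fintype V] {G : SimpleGraph V} [DecidableRel G.Adj] :
    ∑ u, ∑ v, (if G.Adj u v then (1 : ℝ) else 0) = 2 * (G.edgeSet.ncard : ℝ) := by
  classical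
  have : ∀ u, ∑ v, (if G.Adj u v then (1 : ℝ) else 0) = G.degree u := fun u => by
    rw [sum_boole, ← SimpleGraph.card_neighborFinset_eq_degree,
      SimpleGraph.neighborFinset_eq_filter]
  simp only [this]
  rw [← SimpleGraph.coe_edgeFinset, Set.ncard_coe_finset]
  exact_mod_cast G.sum_degrees_eq_twice_card_edges

lemma card_le_two_mul_ncard_edgeSet [Fintype V] [Nontrivial V] {G : SimpleGraph V}
    (hG : G.Connected) : Fintype.card V ≤ 2 * G.edgeSet.ncard := by
  classical
  rw [← SimpleGraph.coe_edgeFinset, Set.ncard_coe_finset, ← G.sum_degrees_eq_twice_card_edges,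
    ← card_univ, card_eq_sum_ones]
  exact sum_le_sum fun v _ => hG.preconnected.degree_pos_of_nontrivial v

/-- The preconditioner, in terms of the parameters of the low-stretch tree. -/
theorem exists_preconditioner_of_parameters [Fintype V] [DecidableEq V] [Nontrivial V]
    (hw : IsWeighting w) (hconn : (SimpleGraph.fromEdgeSet (edgeSetW w)).Connected) {t : ℕ}
    (ht : 0 < t) (htn : t ≤ Fintype.card V) {y K Y : ℝ} (hK : 1 < K) {R : ℕ} (hy : 4 * R + 2 ≤ y)
    (hR : (Fintype.card V : ℝ) + 1 ≤ (1 + 1 / (8 * K)) ^ R) (hY1 : 1 ≤ Y)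
    (hY : ∀ s : ℕ, K ^ s ≤ 2 * (Fintype.card V : ℝ) ^ 2 → y ^ 2 * (y / K) ^ s ≤ Y) :
    ∃ R S : Set (Sym2 V), R ⊆ edgeSetW w ∧ S ⊆ edgeSetW w ∧
      (SimpleGraph.fromEdgeSet R).IsTree ∧ (S.ncard : ℝ) ≤ 25 * (t : ℝ) ^ 2 ∧
      ∀ x : V → ℝ,
        x ⬝ᵥ (lap (restrictW w (R ∪ S)) *ᵥ x) ≤ x ⬝ᵥ (lap w *ᵥ x) ∧
        x ⬝ᵥ (lap w *ᵥ x) ≤ ((edgeSetW w).ncard / t : ℝ) * (96 * Y) *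
          (x ⬝ᵥ (lap (restrictW w (R ∪ S)) *ᵥ x)) := by
  classical
  set G := SimpleGraph.fromEdgeSet (edgeSetW w) with hG
  set m : ℝ := ((edgeSetW w).ncard : ℝ) with hm
  set ω : Sym2 V → ℝ := Sym2.lift ⟨w, hw.symm⟩ with hω
  set d : Sym2 V → ℝ := fun e => (ω e)⁻¹ with hd
  have hd0 : ∀ e, 0 ≤ d e := fun e => inv_nonneg.2 <| by
    induction e with | _ u v => exact hw.nonneg u v
  have hdw : ∀ u v, 0 < w u v → w u v * d s(u, v) = 1 := fun u v h => mul_inv_cancel₀ h.ne'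
  have hK0 : 0 < K := by linarith
  obtain ⟨T, hTG, hT, s, hs, hsum⟩ := exists_lowStretch_tree hconn (d := d)
    (fun u v h => inv_pos.2 (hw.adj_iff.1 h)) hK hy hR
  have hTw : ∀ u v, T.Adj u v → 0 < w u v := fun u v h => hw.adj_iff.1 (hTG h)
  have hM : ∑ u, ∑ v, (if G.Adj u v then (1 : ℝ) else 0) = 2 * m := by
    rw [sum_sum_adj_eq, hG, edgeSet_fromEdgeSet_edgeSetW]
  rw [hM] at hsum
  have hMn : 2 * m ≤ (Fintype.card V : ℝ) ^ 2 := by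
    rw [← hM]
    calc _ ≤ ∑ _u : V, ∑ _v : V, (1 : ℝ) := by
          gcongr; split_ifs <;> norm_num
      _ = _ := by simp [sq]
  have hnm : (t : ℝ) ≤ 2 * m := by
    have := card_le_two_mul_ncard_edgeSet hconn
    rw [edgeSet_fromEdgeSet_edgeSetW] at this
    rw [hm]
    exact_mod_cast htn.trans this
  have hKs : ∀ u v, G.Adj u v → K ^ s u v ≤ 2 * (Fintype.card V : ℝ) ^ 2 := by
    intro u v h
    have hterm : ∀ a b, 0 ≤ (if G.Adj a b then K ^ s a b else 0) := fun a b => by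
      split_ifs
      exacts [by positivity, le_rfl]
    calc K ^ s u v = if G.Adj u v then K ^ s u v else 0 := (if_pos h).symm
      _ ≤ ∑ b, (if G.Adj u b then K ^ s u b else 0) :=
          single_le_sum (f := fun b => if G.Adj u b then K ^ s u b else 0)
            (fun b _ => hterm u b) (mem_univ v)
      _ ≤ ∑ a, ∑ b, (if G.Adj a b then K ^ s a b else 0) :=
          single_le_sum (f := fun a => ∑ b, if G.Adj a b then K ^ s a b else 0)
            (fun a _ => sum_nonneg fun b _ => hterm a b) (mem_univ u)
      _ ≤ _ := by linarith
  have hstretch : ∑ u, ∑ v, w u v * (treeDist T d u v + d s(u, v)) ≤ 2 * m * (2 * Y + 1) := by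
    calc ∑ u, ∑ v, w u v * (treeDist T d u v + d s(u, v))
        ≤ ∑ u, ∑ v, (Y * (if G.Adj u v then K ^ s u v else 0) +
            if G.Adj u v then (1 : ℝ) else 0) := by
          refine sum_le_sum fun u _ => sum_le_sum fun v _ => ?_
          split_ifs with h
          · obtain ⟨p, hp⟩ := hs u v h
            have hpos := hw.adj_iff.1 h
            have h1 : treeDist T d u v ≤ y ^ (s u v + 2) * d s(u, v) :=
              (treeDist_le_walkLen hd0 p).trans hp
            have h2 : y ^ (s u v + 2) ≤ Y * K ^ s u v := by
              calc y ^ (s u v + 2) = y ^ 2 * (y / K) ^ s u v * K ^ s u v := by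
                    rw [mul_assoc, ← mul_pow, div_mul_cancel₀ _ hK0.ne', ← pow_add, add_comm]
                _ ≤ _ := by gcongr; exact hY _ (hKs u v h)
            calc w u v * (treeDist T d u v + d s(u, v))
                ≤ w u v * (y ^ (s u v + 2) * d s(u, v) + d s(u, v)) := by gcongr
              _ = (y ^ (s u v + 2) + 1) * (w u v * d s(u, v)) := by ring
              _ ≤ _ := by rw [hdw u v hpos, mul_one]; gcongr
          · have : w u v = 0 := le_antisymm (not_lt.1 fun h' => h (hw.adj_iff.2 h')) (hw.nonneg u v)
            simp [this]
      _ = Y * ∑ u, ∑ v, (if G.Adj u v then K ^ s u v else 0) + 2 * m := by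
          simp only [sum_add_distrib, ← mul_sum, hM]
      _ ≤ Y * (2 * (2 * m)) + 2 * m := by gcongr
      _ = _ := by ring
  have ht0 : (0 : ℝ) < t := by exact_mod_cast ht
  have hθ : 0 < 2 * m * (2 * Y + 1) / t := by
    apply div_pos (mul_pos _ _) ht0 <;> linarith
  obtain ⟨N, S, hN, hS, hSN, hx⟩ := exists_sparse_approximation hw hT hTw hd0 hdw hθ
  refine ⟨T.edgeSet, S, ?_, hS, by rwa [SimpleGraph.fromEdgeSet_edgeSet], ?_, fun x => ?_⟩
  · rw [← edgeSet_fromEdgeSet_edgeSetW w]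
    exact SimpleGraph.edgeSet_mono hTG
  · have h1 : (N : ℝ) ≤ 5 * t := by
      refine le_of_mul_le_mul_right (hN.trans ?_) hθ
      have h2 : 2 * m * (2 * Y + 1) = t * (2 * m * (2 * Y + 1) / t) := by field_simp
      have h3 : 1 * (2 * m * (2 * Y + 1) / t) ≤ t * (2 * m * (2 * Y + 1) / t) := by
        gcongr
        exact_mod_cast ht
      linarith
    calc (S.ncard : ℝ) ≤ ((N ^ 2 : ℕ) : ℝ) := by exact_mod_cast hSN
      _ = (N : ℝ) ^ 2 := by push_cast; rfl
      _ ≤ (5 * t) ^ 2 := by gcongr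
      _ = _ := by ring
  · have hwr := hw.isWeighting_restrictW (T.edgeSet ∪ S)
    rw [dotProduct_lap_mulVec hw, dotProduct_lap_mulVec hwr]
    constructor
    · gcongr
      exact restrictW_le hw _ _ _
    · have hfac : 15 * (2 * m * (2 * Y + 1) / t) + 3 ≤ m / t * (96 * Y) := by
        rw [div_mul_eq_mul_div, mul_div_assoc', div_add' _ _ _ ht0.ne',
          div_le_div_iff_of_pos_right ht0]
        nlinarith
      have hQ : 0 ≤ ∑ u, ∑ v, restrictW w (T.edgeSet ∪ S) u v * (x u - x v) ^ 2 :=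
        sum_nonneg fun u _ => sum_nonneg fun v _ => mul_nonneg (hwr.nonneg u v) (sq_nonneg _)
      have := (hx x).trans (mul_le_mul_of_nonneg_right hfac hQ)
      linarith

end Laplacian

section Parameters

lemma one_div_twenty_le_log_log {n : ℕ} (hn : 3 ≤ n) : 1 / 20 ≤ Real.log (Real.log n) := by
  have h3 : (1.06 : ℝ) ≤ Real.log n := by
    rw [Real.le_log_iff_exp_le (by positivity)]
    have h1 : Real.exp 0.06 ≤ 1.07 := by
      have := Real.one_sub_le_exp_neg 0.06
      rw [Real.exp_neg, le_inv_comm₀ (by norm_num) (Real.exp_pos _)] at this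
      exact this.trans (by norm_num)
    calc Real.exp 1.06 = Real.exp 1 * Real.exp 0.06 := by rw [← Real.exp_add]; norm_num
      _ ≤ 2.7182818286 * 1.07 := by
          gcongr
          exact Real.exp_one_lt_d9.le
      _ ≤ 3 := by norm_num
      _ ≤ n := by exact_mod_cast hn
  have h0 : 0 < Real.log n := by linarith
  have h1 := Real.one_sub_inv_le_log_of_pos h0
  have h2 : (Real.log n)⁻¹ ≤ (1.06 : ℝ)⁻¹ := by gcongr
  norm_num at h2 ⊢
  linarith

lemma exp_five_ge : (134 : ℝ) ≤ Real.exp 5 := by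
  calc (134 : ℝ) ≤ 2.7182818283 ^ 5 := by norm_num
    _ ≤ Real.exp 1 ^ 5 := by
        gcongr
        exact Real.exp_one_gt_d9.le
    _ = Real.exp 5 := by rw [← Real.exp_nat_mul]; norm_num

/-- The parameters of the low-stretch tree: the stretch is `exp (O(√(log n · log log n)))`. -/
theorem exists_parameters {n : ℕ} (hn : 3 ≤ n) :
    ∃ (y K Y : ℝ) (R : ℕ), 1 < K ∧ 4 * R + 2 ≤ y ∧ (n : ℝ) + 1 ≤ (1 + 1 / (8 * K)) ^ R ∧ 1 ≤ Y ∧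
      (∀ s : ℕ, K ^ s ≤ 2 * (n : ℝ) ^ 2 → y ^ 2 * (y / K) ^ s ≤ Y) ∧
      96 * Y ≤ 2 ^ (1000 * √(Real.log n * Real.log (Real.log n))) := by
  have hl20 := one_div_twenty_le_log_log hn
  set ℓ := Real.log n with hℓ
  set lam := Real.log ℓ with hlam
  set σ := √(ℓ * lam) with hσ
  have hn3 : (3 : ℝ) ≤ n := by exact_mod_cast hn
  have hlam0 : 0 < lam := by linarith
  have hℓ0 : 0 ≤ ℓ := Real.log_nonneg (by linarith)
  have hℓ1 : 1 < ℓ := by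
    by_contra! h
    exact hlam0.not_ge (Real.log_nonpos hℓ0 h)
  have hlamℓ : lam ≤ ℓ := (Real.log_le_sub_one_of_pos (by linarith)).trans (by linarith)
  have hσsq : σ * σ = ℓ * lam := Real.mul_self_sqrt (by positivity)
  have hlamσ : lam ≤ σ := Real.le_sqrt_of_sq_le (by rw [sq]; gcongr)
  have hσ0 : 0 < σ := by linarith
  set K := Real.exp σ with hKdef
  have hK1 : 1 < K := Real.one_lt_exp_iff.2 hσ0
  set R := ⌈16 * K * Real.log (n + 1)⌉₊ with hR
  have hlog : Real.log (n + 1) ≤ 2 * ℓ := by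
    rw [hℓ, ← Nat.cast_two, ← Real.log_pow]
    exact Real.log_le_log (by linarith) (by nlinarith)
  have hlog0 : 0 ≤ Real.log ((n : ℝ) + 1) := Real.log_nonneg (by linarith)
  have hRle : (R : ℝ) ≤ 32 * K * ℓ + 1 := by
    have := Nat.ceil_lt_add_one (a := 16 * K * Real.log (n + 1)) (by positivity)
    have h2 : 16 * K * Real.log (n + 1) ≤ 16 * K * (2 * ℓ) := by gcongr
    linarith
  have hKℓ : 1 ≤ K * ℓ := one_le_mul_of_one_le_of_one_le hK1.le hℓ1.le
  have hy : 4 * (R : ℝ) + 2 ≤ K * (134 * ℓ) := by nlinarith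
  have hq : Real.log (134 * ℓ) ≤ 101 * lam := by
    rw [Real.log_mul (by norm_num) (by linarith)]
    have : Real.log 134 ≤ 5 := (Real.log_le_iff_le_exp (by norm_num)).2 exp_five_ge
    linarith
  refine ⟨K * (134 * ℓ), K, Real.exp (507 * σ), R, hK1, hy, ?_, Real.one_le_exp (by positivity),
    fun s hs => ?_, ?_⟩
  · have hε : 0 < 1 / (8 * K) := by positivity
    have hε1 : 1 / (8 * K) ≤ 1 := by
      rw [div_le_one (by positivity)]
      linarith
    have h1 := Real.le_log_one_add_of_nonneg hε.le
    have h2 : 1 / (8 * K) / 2 ≤ 2 * (1 / (8 * K)) / (1 / (8 * K) + 2) := by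
      rw [div_le_div_iff₀ (by norm_num) (by positivity)]
      nlinarith
    rw [← Real.log_le_log_iff (by positivity) (by positivity), Real.log_pow]
    calc Real.log (n + 1) = 16 * K * Real.log (n + 1) * (1 / (8 * K) / 2) := by
          field_simp
          ring
      _ ≤ R * Real.log (1 + 1 / (8 * K)) := by
          gcongr
          · exact Nat.le_ceil _
          · exact h2.trans h1
  · have hsσ : s * σ ≤ 3 * ℓ := by
      have h1 : K ^ s ≤ (n : ℝ) ^ 3 := hs.trans (by nlinarith [sq_nonneg (n : ℝ)])
      have h2 := Real.log_le_log (by positivity) h1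
      rw [Real.log_pow, Real.log_pow, Real.log_exp] at h2
      exact_mod_cast h2
    have hslam : s * lam ≤ 3 * σ := by
      refine le_of_mul_le_mul_right ?_ hσ0
      nlinarith
    rw [mul_div_cancel_left₀ _ (by positivity : K ≠ 0), mul_pow, mul_assoc, ← pow_add,
      ← Real.log_le_log_iff (by positivity) (by positivity), Real.log_mul (by positivity)
      (by positivity), Real.log_pow, Real.log_pow, Real.log_exp, Real.log_exp]
    have : (2 + s : ℝ) * Real.log (134 * ℓ) ≤ (2 + s) * (101 * lam) := by gcongr
    push_cast
    nlinarith
  · rw [← Real.log_le_log_iff (by positivity) (by positivity), Real.log_mul (by norm_num)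
      (by positivity), Real.log_exp, Real.log_rpow (by norm_num)]
    have h1 : Real.log 96 ≤ 5 :=
      (Real.log_le_iff_le_exp (by norm_num)).2 (le_trans (by norm_num) exp_five_ge)
    nlinarith [Real.log_two_gt_d9]

end Parameters

/-- There is a constant `c > 0` such that: for every weighting `w` on a finite set `V` with
`n = |V| ≥ 3` whose graph is connected, with `m` edges and Laplacian `A`, and every positive
integer `t ≤ n`, there are a spanning tree `R ⊆ E(w)` and a set `S ⊆ E(w)` with
`|S| ≤ c·t²·log n/log log n` such that the Laplacian `B` of `w` restricted to `R ∪ S`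
satisfies `xᵀBx ≤ xᵀAx` and `xᵀAx ≤ (m/t)·2^{c√(log n · log log n)}·xᵀBx` for all `x`. -/
theorem preconditioner_exists :
    ∃ c : ℝ, 0 < c ∧
      ∀ (V : Type) [Fintype V] [DecidableEq V] (w : V → V → ℝ),
        IsWeighting w →
        3 ≤ Fintype.card V →
        (SimpleGraph.fromEdgeSet (edgeSetW w)).Connected →
        ∀ t : ℕ, 0 < t → t ≤ Fintype.card V →
          ∃ R S : Set (Sym2 V),
            R ⊆ edgeSetW w ∧ S ⊆ edgeSetW w ∧
            (SimpleGraph.fromEdgeSet R).IsTree ∧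
            (S.ncard : ℝ) ≤ c * (t : ℝ) ^ 2 * Real.log (Fintype.card V) /
                Real.log (Real.log (Fintype.card V)) ∧
            ∀ x : V → ℝ,
              x ⬝ᵥ (lap (restrictW w (R ∪ S)) *ᵥ x) ≤ x ⬝ᵥ (lap w *ᵥ x) ∧
              x ⬝ᵥ (lap w *ᵥ x) ≤
                (((edgeSetW w).ncard : ℝ) / (t : ℝ)) *
                  (2 : ℝ) ^ (c * Real.sqrt (Real.log (Fintype.card V) *
                      Real.log (Real.log (Fintype.card V)))) *
                  (x ⬝ᵥ (lap (restrictW w (R ∪ S)) *ᵥ x)) := by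
  refine ⟨1000, by norm_num, fun V _ _ w hw hn hconn t ht htn => ?_⟩
  have : Nontrivial V := Fintype.one_lt_card_iff_nontrivial.1 (by omega)
  obtain ⟨y, K, Y, k, hK, hy, hk, hY1, hY, hbound⟩ := exists_parameters hn
  obtain ⟨R, S, hR, hS, htree, hcard, hx⟩ :=
    exists_preconditioner_of_parameters hw hconn ht htn hK hy hk hY1 hY
  refine ⟨R, S, hR, hS, htree, hcard.trans ?_, fun x => ⟨(hx x).1, (hx x).2.trans ?_⟩⟩
  · have hll : 0 < Real.log (Real.log (Fintype.card V)) := by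
      linarith [one_div_twenty_le_log_log hn]
    have hl : Real.log (Real.log (Fintype.card V)) ≤ Real.log (Fintype.card V) :=
      Real.log_le_self (Real.log_natCast_nonneg _)
    rw [le_div_iff₀ hll]
    have : (0 : ℝ) ≤ (t : ℝ) ^ 2 := sq_nonneg _
    nlinarith [mul_le_mul_of_nonneg_left hl this, mul_nonneg this hll.le]
  · have hQ : 0 ≤ x ⬝ᵥ (lap (restrictW w (R ∪ S)) *ᵥ x) := by
      have hwr := hw.isWeighting_restrictW (R ∪ S)
      rw [dotProduct_lap_mulVec hwr]
      exact div_nonneg (sum_nonneg fun u _ => sum_nonneg fun v _ =>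
        mul_nonneg (hwr.nonneg u v) (sq_nonneg _)) zero_le_two
    gcongr
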